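/- arXiv:2504.10251 — 10 statements merged into one kernel-verified Lean document; each statement's English description precedes it below -/
import Mathlib

section
/- For all parameters a > 0 and b > 0, the Lengyel–Epstein vector field F_{a,b} is not bounded: there exist T ∈ (0, ∞], an initial point X₀ ∈ ℝ², and a solution γ : [0, T) → ℝ² of γ'(t) = F_{a,b}(γ(t)) with γ(0) = X₀ whose image {γ(t) : t ∈ [0, T)} is an unbounded subset of ℝ² (i.e., the forward orbit is not contained in any compact set). -/
open scoped ENNReal

/-- The Lengyel–Epstein planar vector field with parameters `a`, `b`. -/
noncomputable def lengyelEpstein (a b : ℝ) : ℝ × ℝ → ℝ × ℝ :=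
  fun p => ((a - p.1) * (1 + p.1 ^ 2) - 4 * p.1 * p.2, b * p.1 * (1 + p.1 ^ 2 - p.2))

section MaximalSolution

open Set Filter Topology Manifold

variable {E : Type*} [NormedAddCommGroup E] [NormedSpace ℝ E]

lemma isMIntegralCurveOn_Ioo_iff_hasDerivAt {γ : ℝ → E} {f : E → E} {c d : ℝ} :
    IsMIntegralCurveOn (I := 𝓘(ℝ, E)) γ f (Ioo c d) ↔
      ∀ t ∈ Ioo c d, HasDerivAt γ (f (γ t)) t := by
  refine forall₂_congr fun t ht => ?_
  have hnhds : Ioo c d ∈ 𝓝 t := Ioo_mem_nhds ht.1 ht.2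
  have hiff : HasDerivWithinAt γ (f (γ t)) (Ioo c d) t ↔ HasDerivAt γ (f (γ t)) t :=
    ⟨fun h => h.hasDerivAt hnhds, fun h => h.hasDerivWithinAt⟩
  exact hasMFDerivWithinAt_iff_hasFDerivWithinAt.trans hiff

lemma eqOn_Ioo_of_hasDerivAt {f : E → E} (hf : ContDiff ℝ 1 f) {γ γ' : ℝ → E} {c d t₀ : ℝ}
    (ht₀ : t₀ ∈ Ioo c d) (hγ : ∀ t ∈ Ioo c d, HasDerivAt γ (f (γ t)) t)
    (hγ' : ∀ t ∈ Ioo c d, HasDerivAt γ' (f (γ' t)) t) (h : γ t₀ = γ' t₀) :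
    EqOn γ γ' (Ioo c d) :=
  isMIntegralCurveOn_Ioo_eqOn_of_contMDiff_boundaryless (I := 𝓘(ℝ, E)) (v := f) ht₀
    (contMDiff_vectorSpace_iff_contDiff.2 hf)
    (isMIntegralCurveOn_Ioo_iff_hasDerivAt.2 hγ) (isMIntegralCurveOn_Ioo_iff_hasDerivAt.2 hγ') h

/-- A solution that meets another one can be continued by it to the right. -/
lemma exists_extension_hasDerivAt {f : E → E} (hf : ContDiff ℝ 1 f) {γ γ' : ℝ → E}
    {c d c' d' t₀ : ℝ} (ht₀ : t₀ ∈ Ioo c d) (ht₀' : t₀ ∈ Ioo c' d')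
    (hγ : ∀ t ∈ Ioo c d, HasDerivAt γ (f (γ t)) t)
    (hγ' : ∀ t ∈ Ioo c' d', HasDerivAt γ' (f (γ' t)) t) (h : γ t₀ = γ' t₀) :
    ∃ η : ℝ → E, EqOn η γ (Ioo c d) ∧ ∀ t ∈ Ioo c d', HasDerivAt η (f (η t)) t := by
  classical
  have key := isMIntegralCurveOn_piecewise (I := 𝓘(ℝ, E)) (v := f)
    (contMDiff_vectorSpace_iff_contDiff.2 hf)
    (isMIntegralCurveOn_Ioo_iff_hasDerivAt.2 hγ) (isMIntegralCurveOn_Ioo_iff_hasDerivAt.2 hγ')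
    ⟨ht₀, ht₀'⟩ h
  refine ⟨_, piecewise_eqOn _ _ _, isMIntegralCurveOn_Ioo_iff_hasDerivAt.1 (key.mono ?_)⟩
  intro t ht
  rcases lt_or_ge t d with h1 | h1
  · exact Or.inl ⟨ht.1, h1⟩
  · exact Or.inr ⟨ht₀'.1.trans (ht₀.2.trans_le h1), ht.2⟩

/-- Solutions with the same initial value on intervals with a common left end can be glued. -/
lemma exists_glued_hasDerivAt {f : E → E} (hf : ContDiff ℝ 1 f) {x : E} {c t₀ : ℝ} {S : Set ℝ}
    (hc : c < t₀) (hS : S.Nonempty) (hpos : ∀ τ ∈ S, t₀ < τ)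
    (h : ∀ τ ∈ S, ∃ γ : ℝ → E, γ t₀ = x ∧ ∀ t ∈ Ioo c τ, HasDerivAt γ (f (γ t)) t) :
    ∃ γ : ℝ → E, γ t₀ = x ∧ ∀ τ ∈ S, ∀ t ∈ Ioo c τ, HasDerivAt γ (f (γ t)) t := by
  classical
  choose! φ hφ₀ hφ using h
  have hN : ∀ t, ∃ σ, (∃ τ ∈ S, t < τ) → σ ∈ S ∧ t < σ := fun t => by
    by_cases ht : ∃ τ ∈ S, t < τ
    · obtain ⟨τ, hτ⟩ := ht
      exact ⟨τ, fun _ => hτ⟩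
    · exact ⟨0, fun h => absurd h ht⟩
  choose N hN using hN
  have heq : ∀ τ ∈ S, EqOn (fun t => φ (N t) t) (φ τ) (Ioo c τ) := by
    intro τ hτ t ht
    obtain ⟨hNS, hNt⟩ := hN t ⟨τ, hτ, ht.2⟩
    refine eqOn_Ioo_of_hasDerivAt hf (c := c) (d := min (N t) τ)
      ⟨hc, lt_min (hpos _ hNS) (hpos _ hτ)⟩ (fun s hs => ?_) (fun s hs => ?_)
      ((hφ₀ _ hNS).trans (hφ₀ _ hτ).symm) ⟨ht.1, lt_min hNt ht.2⟩
    · exact hφ _ hNS s ⟨hs.1, hs.2.trans_le (min_le_left _ _)⟩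
    · exact hφ _ hτ s ⟨hs.1, hs.2.trans_le (min_le_right _ _)⟩
  refine ⟨fun t => φ (N t) t, ?_, fun τ hτ t ht => ?_⟩
  · obtain ⟨τ, hτ⟩ := hS
    exact (heq τ hτ ⟨hc, hpos τ hτ⟩).trans (hφ₀ τ hτ)
  · have h1 := (hφ τ hτ t ht).congr_of_eventuallyEq
      ((heq τ hτ).eventuallyEq_of_mem (isOpen_Ioo.mem_nhds ht))
    have h2 : φ (N t) t = φ τ t := heq τ hτ ht
    simpa only [h2] using h1

/-- The solutions starting in a given ball exist for a uniform time. -/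
lemma exists_uniform_time_hasDerivAt [ProperSpace E] {f : E → E} (hf : ContDiff ℝ 1 f) (R : ℝ) :
    ∃ ε > 0, ∀ x : E, ‖x‖ ≤ R → ∀ t₀ : ℝ, ∃ γ : ℝ → E, γ t₀ = x ∧
      ∀ t ∈ Ioo (t₀ - ε) (t₀ + ε), HasDerivAt γ (f (γ t)) t := by
  set r : NNReal := R.toNNReal
  have hcpt : IsCompact (Metric.closedBall (0 : E) (r + 1 : NNReal)) := isCompact_closedBall _ _
  obtain ⟨K, hK⟩ := LocallyLipschitzOn.exists_lipschitzOnWith_of_compact hcpt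
    hf.locallyLipschitz.locallyLipschitzOn
  obtain ⟨C, hC⟩ := hcpt.exists_bound_of_continuousOn hf.continuous.continuousOn
  set L : NNReal := C.toNNReal
  have hL : (0 : ℝ) < L + 1 := by positivity
  refine ⟨1 / (L + 1), by positivity, fun x hx t₀ => ?_⟩
  set ε : ℝ := 1 / (L + 1)
  have hε : 0 < ε := by positivity
  have hpl : IsPicardLindelof (fun _ : ℝ => f) (tmin := t₀ - ε) (tmax := t₀ + ε)
      ⟨t₀, by linarith, by linarith⟩ (0 : E) (r + 1) r L K := by
    refine IsPicardLindelof.of_time_independent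
      (fun y hy => (hC y hy).trans (Real.le_coe_toNNReal C)) hK ?_
    simp only [add_sub_cancel_left, sub_sub_cancel, max_self, NNReal.coe_add, NNReal.coe_one]
    rw [mul_one_div, div_le_one hL]
    linarith
  obtain ⟨γ, hγ₀, hγ⟩ := hpl.exists_eq_forall_mem_Icc_hasDerivWithinAt (x := x)
    (mem_closedBall_zero_iff.2 (hx.trans (Real.le_coe_toNNReal R)))
  exact ⟨γ, hγ₀, fun t ht => (hγ t (Ioo_subset_Icc_self ht)).hasDerivAt (Icc_mem_nhds ht.1 ht.2)⟩

/-- A maximal forward solution of an autonomous `C¹` equation is either defined for all times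
or has unbounded image. -/
theorem exists_hasDerivAt_eq_top_or_not_isBounded [ProperSpace E] {f : E → E}
    (hf : ContDiff ℝ 1 f) (x : E) :
    ∃ (T : ℝ≥0∞) (γ : ℝ → E), 0 < T ∧ γ 0 = x ∧
      (∀ t : ℝ, 0 ≤ t → ENNReal.ofReal t < T → HasDerivAt γ (f (γ t)) t) ∧
      (T = ⊤ ∨ ¬ Bornology.IsBounded (γ '' {t : ℝ | 0 ≤ t ∧ ENNReal.ofReal t < T})) := by
  obtain ⟨ε, hε, hloc⟩ := exists_uniform_time_hasDerivAt hf ‖x‖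
  obtain ⟨γ₀, hγ₀, hγ₀'⟩ := hloc x le_rfl 0
  set S : Set ℝ := {τ | 0 < τ ∧ ∃ γ : ℝ → E, γ 0 = x ∧
    ∀ t ∈ Ioo (-ε) τ, HasDerivAt γ (f (γ t)) t}
  have hεS : ε ∈ S := ⟨hε, γ₀, hγ₀, by simpa using hγ₀'⟩
  obtain ⟨γ, hγx, hγ⟩ := exists_glued_hasDerivAt hf (c := -ε) (t₀ := 0) (x := x) (S := S)
    (by linarith) ⟨ε, hεS⟩ (fun τ hτ => hτ.1) (fun τ hτ => hτ.2)
  by_cases hS : BddAbove S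
  · have hT : 0 < sSup S := hε.trans_le (le_csSup hS hεS)
    have hγT : ∀ t ∈ Ioo (-ε) (sSup S), HasDerivAt γ (f (γ t)) t := fun t ht => by
      obtain ⟨τ, hτ, htτ⟩ := exists_lt_of_lt_csSup ⟨ε, hεS⟩ ht.2
      exact hγ τ hτ t ⟨ht.1, htτ⟩
    refine ⟨ENNReal.ofReal (sSup S), γ, by simpa using hT, hγx, fun t ht htT => ?_,
      Or.inr fun hb => ?_⟩
    · exact hγT t ⟨by linarith, (ENNReal.ofReal_lt_ofReal_iff hT).1 htT⟩
    obtain ⟨R, hR⟩ := hb.exists_norm_le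
    obtain ⟨δ, hδ, hext⟩ := exists_uniform_time_hasDerivAt hf R
    obtain ⟨s, hs1, hs2⟩ := exists_between (max_lt hT (sub_lt_self (sSup S) hδ))
    obtain ⟨hs0, hsδ⟩ := max_lt_iff.1 hs1
    obtain ⟨β, hβ₀, hβ⟩ := hext (γ s)
      (hR _ ⟨s, ⟨hs0.le, (ENNReal.ofReal_lt_ofReal_iff hT).2 hs2⟩, rfl⟩) s
    obtain ⟨η, hη, hη'⟩ := exists_extension_hasDerivAt hf (c := -ε) (t₀ := s)
      ⟨by linarith, hs2⟩ ⟨by linarith, by linarith⟩ hγT hβ hβ₀.symm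
    have : s + δ ∈ S :=
      ⟨by linarith, η, (hη ⟨by linarith, hT⟩).trans hγx, hη'⟩
    linarith [le_csSup hS this]
  · refine ⟨⊤, γ, by simp, hγx, fun t ht _ => ?_, Or.inl rfl⟩
    obtain ⟨τ, hτ, htτ⟩ := not_bddAbove_iff.1 hS t
    exact hγ τ hτ t ⟨by linarith, htτ⟩

end MaximalSolution

section LengyelEpstein

open Set Filter Topology

lemma HasDerivAt.eventually_nhdsGT_lt {g : ℝ → ℝ} {g' t : ℝ} (h : HasDerivAt g g' t)
    (hg' : g' < 0) : ∀ᶠ s in 𝓝[>] t, g s < g t := by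
  filter_upwards [(h.hasDerivWithinAt (s := Ioi t)).limsup_slope_le' (by simp) hg',
    self_mem_nhdsWithin] with s hs hts
  have hts : t < s := hts
  rw [slope_def_field, div_lt_iff₀ (by linarith)] at hs
  linarith

lemma contDiff_lengyelEpstein (a b : ℝ) : ContDiff ℝ 1 (lengyelEpstein a b) := by
  unfold lengyelEpstein
  fun_prop

/-- The quadrant `x ≤ -1`, `y ≤ -(a + 1)` is forward invariant. -/
lemma lengyelEpstein_forward_invariant {a b : ℝ} (ha : 0 < a) (hb : 0 < b) {γ : ℝ → ℝ × ℝ}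
    (hγ : ∀ t, 0 ≤ t → HasDerivAt γ (lengyelEpstein a b (γ t)) t)
    (h₀ : γ 0 = (-1, -(a + 1))) {t : ℝ} (ht : 0 ≤ t) :
    (γ t).1 ≤ -1 ∧ (γ t).2 ≤ -(a + 1) := by
  have hcont : ContinuousOn γ (Icc 0 t) :=
    fun s hs => (hγ s hs.1).continuousAt.continuousWithinAt
  have hclosed : IsClosed ({s | γ s ∈ Iic (-1) ×ˢ Iic (-(a + 1))} ∩ Icc 0 t) := by
    rw [inter_comm]
    exact hcont.preimage_isClosed_of_isClosed isClosed_Icc (isClosed_Iic.prod isClosed_Iic)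
  refine (hclosed.Icc_subset_of_forall_mem_nhdsWithin (by simp [h₀]) ?_) ⟨ht, le_rfl⟩
  rintro s ⟨⟨hx, hy⟩, hs⟩
  simp only [mem_Iic] at hx hy
  have hd := hγ s hs.1
  have hx' : ∀ᶠ r in 𝓝[>] s, (γ r).1 ≤ -1 := by
    rcases hx.lt_or_eq with h | h
    · exact ((hd.continuousAt.fst.eventually_lt_const h).filter_mono
        nhdsWithin_le_nhds).mono fun _ h => h.le
    · refine ((hasFDerivAt_fst.comp_hasDerivAt s hd).eventually_nhdsGT_lt ?_).mono
        fun r hr => (hr.trans_eq h).le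
      simp only [lengyelEpstein, ContinuousLinearMap.coe_fst', h]
      linarith
  have hy' : ∀ᶠ r in 𝓝[>] s, (γ r).2 ≤ -(a + 1) := by
    refine ((hasFDerivAt_snd.comp_hasDerivAt s hd).eventually_nhdsGT_lt ?_).mono
      fun r hr => hr.le.trans hy
    simp only [lengyelEpstein, ContinuousLinearMap.coe_snd']
    exact mul_neg_of_neg_of_pos (mul_neg_of_pos_of_neg hb (by linarith))
      (by linarith [sq_nonneg (γ s).1])
  filter_upwards [hx', hy'] with r h1 h2 using ⟨h1, h2⟩

/-- For all parameters `a > 0`, `b > 0`, the Lengyel–Epstein vector field is not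
bounded: there are `T ∈ (0, ∞]`, an initial point `X₀` and a solution
`γ : [0, T) → ℝ²` starting at `X₀` whose forward orbit is unbounded. -/
theorem lengyelEpstein_not_bounded (a b : ℝ) (ha : 0 < a) (hb : 0 < b) :
    ∃ (T : ℝ≥0∞) (X₀ : ℝ × ℝ) (γ : ℝ → ℝ × ℝ), 0 < T ∧ γ 0 = X₀ ∧
      (∀ t : ℝ, 0 ≤ t → ENNReal.ofReal t < T →
        HasDerivAt γ (lengyelEpstein a b (γ t)) t) ∧
      ¬ Bornology.IsBounded (γ '' {t : ℝ | 0 ≤ t ∧ ENNReal.ofReal t < T}) := by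
  obtain ⟨T, γ, hT, h₀, hγ, htop | hunb⟩ := exists_hasDerivAt_eq_top_or_not_isBounded
    (contDiff_lengyelEpstein a b) (-1, -(a + 1))
  swap
  · exact ⟨T, _, γ, hT, h₀, hγ, hunb⟩
  subst htop
  refine ⟨⊤, _, γ, hT, h₀, hγ, fun hbdd => ?_⟩
  replace hγ : ∀ t, 0 ≤ t → HasDerivAt γ (lengyelEpstein a b (γ t)) t :=
    fun t ht => hγ t ht ENNReal.ofReal_lt_top
  have hy : ∀ t, 0 ≤ t →
      HasDerivAt (fun t => (γ t).2) (b * (γ t).1 * (1 + (γ t).1 ^ 2 - (γ t).2)) t :=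
    fun t ht => (hasFDerivAt_snd (𝕜 := ℝ) (p := γ t)).comp_hasDerivAt t (hγ t ht)
  have hle : ∀ t, 0 ≤ t → (γ t).2 ≤ -b * t := fun t ht => by
    have := (convex_Ici (0 : ℝ)).image_sub_le_mul_sub_of_deriv_le (f := fun t => (γ t).2) (C := -b)
      (fun s hs => (hy s hs).continuousAt.continuousWithinAt)
      (fun s hs => (hy s (interior_subset hs)).differentiableAt.differentiableWithinAt)
      (fun s hs => by
        have hs := interior_subset hs
        rw [(hy s hs).deriv]
        obtain ⟨h1, h2⟩ := lengyelEpstein_forward_invariant ha hb hγ h₀ hs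
        have h3 : 1 ≤ -(γ s).1 * (1 + (γ s).1 ^ 2 - (γ s).2) :=
          one_le_mul_of_one_le_of_one_le (by linarith) (by linarith [sq_nonneg (γ s).1])
        linarith [mul_le_mul_of_nonneg_left h3 hb.le])
      0 self_mem_Ici t ht ht
    rw [h₀] at this
    dsimp only at this
    linarith
  obtain ⟨R, hR⟩ := hbdd.exists_norm_le
  have ht : 0 ≤ (|R| + 1) / b := by positivity
  have h1 := hle _ ht
  have h2 := hR _ ⟨_, ⟨ht, ENNReal.ofReal_lt_top⟩, rfl⟩
  rw [neg_mul, mul_div_cancel₀ _ hb.ne'] at h1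
  linarith [(norm_snd_le (γ ((|R| + 1) / b))).trans h2, le_abs_self R,
    neg_le_abs (γ ((|R| + 1) / b)).2, Real.norm_eq_abs (γ ((|R| + 1) / b)).2]

end LengyelEpstein
end

section
/- For all parameters a > 0 and b > 0, the equilibrium P_a = (a/5, 1 + a²/25) of the Lengyel–Epstein vector field F_{a,b} is not globally asymptotically stable: there exists an initial point X₀ ∈ ℝ² such that no solution γ : [0, ∞) → ℝ² of γ'(t) = F_{a,b}(γ(t)) with γ(0) = X₀ satisfies γ(t) → P_a as t → ∞. -/
/-- The unique equilibrium point of the Lengyel–Epstein system. -/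
noncomputable def lengyelEpsteinEq (a : ℝ) : ℝ × ℝ := (a / 5, 1 + a ^ 2 / 25)

open Set Filter Topology in
/-- A real function that stays below its value at `t` just before `t` cannot have a negative
derivative at `t`. -/
theorem HasDerivAt.nonneg_of_eventually_le_left {f : ℝ → ℝ} {f' t : ℝ}
    (hf : HasDerivAt f f' t) (h : ∀ᶠ s in 𝓝[<] t, f s ≤ f t) : 0 ≤ f' := by
  have hslope : Tendsto (slope f t) (𝓝[<] t) (𝓝 f') :=
    (hasDerivAt_iff_tendsto_slope.1 hf).mono_left
      (nhdsWithin_mono t fun s (hs : s < t) => hs.ne)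
  refine ge_of_tendsto hslope ?_
  filter_upwards [h, self_mem_nhdsWithin] with s hs hst
  rw [slope_def_field]
  exact div_nonneg_of_nonpos (sub_nonpos.2 hs) (sub_nonpos.2 (le_of_lt hst))

open Set in
/-- A solution of the Lengyel–Epstein system that starts at `(-2, -(a + 1))` never leaves the
quadrant `x < -1`, `y < -(a + 1) / 2`. -/
theorem lengyelEpstein_mem_quadrant {a b : ℝ} (ha : 0 < a) (hb : 0 < b) {γ : ℝ → ℝ × ℝ}
    (h0 : γ 0 = (-2, -(a + 1)))
    (hγ : ∀ t : ℝ, 0 ≤ t → HasDerivAt γ (lengyelEpstein a b (γ t)) t) {t : ℝ} (ht : 0 ≤ t) :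
    (γ t).1 < -1 ∧ (γ t).2 < -(a + 1) / 2 := by
  by_contra hcon
  have hx : ∀ s, 0 ≤ s → HasDerivAt (fun r => (γ r).1)
      ((a - (γ s).1) * (1 + (γ s).1 ^ 2) - 4 * (γ s).1 * (γ s).2) s := fun s hs =>
    (ContinuousLinearMap.fst ℝ ℝ ℝ).hasFDerivAt.comp_hasDerivAt s (hγ s hs)
  have hy : ∀ s, 0 ≤ s → HasDerivAt (fun r => (γ r).2)
      (b * (γ s).1 * (1 + (γ s).1 ^ 2 - (γ s).2)) s := fun s hs =>
    (ContinuousLinearMap.snd ℝ ℝ ℝ).hasFDerivAt.comp_hasDerivAt s (hγ s hs)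
  have hcont : ContinuousOn γ (Ici 0) := fun s hs => (hγ s hs).continuousAt.continuousWithinAt
  set S : Set ℝ := Ici 0 ∩ γ ⁻¹' {p | -1 ≤ p.1 ∨ -(a + 1) / 2 ≤ p.2}
  have hclosed : IsClosed S :=
    hcont.preimage_isClosed_of_isClosed isClosed_Ici
      ((isClosed_le continuous_const continuous_fst).union
        (isClosed_le continuous_const continuous_snd))
  have hne : S.Nonempty := by
    refine ⟨t, ht, ?_⟩
    by_contra hn
    obtain ⟨h1, h2⟩ := not_or.1 hn
    exact hcon ⟨not_le.1 h1, not_le.1 h2⟩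
  have hbdd : BddBelow S := ⟨0, fun s hs => hs.1⟩
  obtain ⟨hT0, hT⟩ := hclosed.csInf_mem hne hbdd
  set T := sInf S
  have hbefore : ∀ s, 0 ≤ s → s < T → (γ s).1 < -1 ∧ (γ s).2 < -(a + 1) / 2 := by
    intro s hs hsT
    by_contra hn
    refine notMem_of_lt_csInf hsT hbdd ⟨hs, ?_⟩
    rw [not_and_or, not_lt, not_lt] at hn
    exact hn
  simp only [mem_Ici] at hT0
  simp only [mem_preimage, mem_ofPred_eq] at hT
  have hTpos : 0 < T := by
    refine hT0.lt_of_ne fun h => ?_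
    rw [← h, h0] at hT
    rcases hT with h | h <;> norm_num at h <;> linarith
  have hanti : AntitoneOn (fun r => (γ r).2) (Icc 0 T) := by
    refine antitoneOn_of_hasDerivWithinAt_nonpos (convex_Icc 0 T)
      (fun s hs => (hy s hs.1).continuousAt.continuousWithinAt)
      (fun s hs => (hy s (interior_subset hs).1).hasDerivWithinAt) fun s hs => ?_
    rw [interior_Icc] at hs
    obtain ⟨h1, h2⟩ := hbefore s hs.1.le hs.2
    refine mul_nonpos_of_nonpos_of_nonneg (mul_nonpos_of_nonneg_of_nonpos hb.le (by linarith)) ?_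
    nlinarith [sq_nonneg (γ s).1]
  have hyT : (γ T).2 ≤ -(a + 1) := by
    simpa [h0] using hanti (left_mem_Icc.2 hT0) (right_mem_Icc.2 hT0) hT0
  have hxT : -1 ≤ (γ T).1 := hT.resolve_right (by linarith)
  have hleft : ∀ᶠ s in nhdsWithin T (Iio T), (γ s).1 < -1 := by
    filter_upwards [Ioo_mem_nhdsLT hTpos] with s hs using (hbefore s hs.1.le hs.2).1
  have hxT' : (γ T).1 = -1 :=
    le_antisymm
      (le_of_tendsto ((hx T hT0).continuousAt.tendsto.mono_left nhdsWithin_le_nhds)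
        (hleft.mono fun _ h => h.le)) hxT
  have hderiv := (hx T hT0).nonneg_of_eventually_le_left
    (hleft.mono fun s h => h.le.trans hxT)
  rw [hxT'] at hderiv
  linarith

/-- For all parameters `a > 0`, `b > 0`, the equilibrium `P_a` is not globally
asymptotically stable: there is an initial point `X₀` such that no solution
`γ : [0, ∞) → ℝ²` with `γ 0 = X₀` converges to `P_a` as `t → ∞`. -/
theorem lengyelEpstein_not_globally_stable (a b : ℝ) (ha : 0 < a) (hb : 0 < b) :
    ∃ X₀ : ℝ × ℝ, ∀ γ : ℝ → ℝ × ℝ, γ 0 = X₀ →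
      (∀ t : ℝ, 0 ≤ t → HasDerivAt γ (lengyelEpstein a b (γ t)) t) →
      ¬ Filter.Tendsto γ Filter.atTop (nhds (lengyelEpsteinEq a)) := by
  refine ⟨(-2, -(a + 1)), fun γ h0 hγ hlim => ?_⟩
  have hfst : Filter.Tendsto (fun t => (γ t).1) Filter.atTop (nhds (a / 5)) :=
    (continuous_fst.tendsto (lengyelEpsteinEq a)).comp hlim
  have hle : a / 5 ≤ -1 := by
    refine le_of_tendsto hfst ?_
    filter_upwards [Filter.eventually_ge_atTop 0] with t ht
    exact (lengyelEpstein_mem_quadrant ha hb h0 hγ ht).1.le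
  linarith
end

section
/- If (a, b) ∈ B, then the equilibrium P_a = (a/5, 1 + a²/25) of the Lengyel–Epstein vector field F_{a,b} is locally asymptotically stable: (i) for every ε > 0 there exists δ > 0 such that every solution γ : [0, ∞) → ℝ² of γ'(t) = F_{a,b}(γ(t)) with ‖γ(0) − P_a‖ < δ satisfies ‖γ(t) − P_a‖ < ε for all t ≥ 0, and (ii) there exists δ₀ > 0 such that every solution γ : [0, ∞) → ℝ² of γ'(t) = F_{a,b}(γ(t)) with ‖γ(0) − P_a‖ < δ₀ satisfies γ(t) → P_a as t → ∞. -/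
/-- The parameter set `B`. -/
noncomputable def paramSetB : Set (ℝ × ℝ) :=
  {p | 0 < p.1 ∧ p.1 ≤ 5 * Real.sqrt (5 / 3) ∧ 0 < p.2} ∪
  {p | 5 * Real.sqrt (5 / 3) < p.1 ∧ (3 * p.1 ^ 2 - 125) / (5 * p.1) < p.2}

open Filter Topology in
/-- Lyapunov's direct method with a differentiable function comparable to the squared distance
to `P` and decaying exponentially along the vector field near `P`. -/
theorem asymptotically_stable_of_lyapunov {E : Type*} [NormedAddCommGroup E] [NormedSpace ℝ E]
    {F : E → E} {P : E} {W : E → ℝ} {W' : E → E →L[ℝ] ℝ} {m M k r : ℝ}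
    (hm : 0 < m) (hM : 0 < M) (hk : 0 < k) (hr : 0 < r)
    (hW : ∀ x, HasFDerivAt W (W' x) x)
    (hlow : ∀ x, m * ‖x - P‖ ^ 2 ≤ W x) (hupp : ∀ x, W x ≤ M * ‖x - P‖ ^ 2)
    (hdec : ∀ x, ‖x - P‖ < r → W' x (F x) ≤ -k * W x) :
    (∀ ε > (0 : ℝ), ∃ δ > (0 : ℝ), ∀ γ : ℝ → E,
      (∀ t : ℝ, 0 ≤ t → HasDerivAt γ (F (γ t)) t) →
      ‖γ 0 - P‖ < δ → ∀ t : ℝ, 0 ≤ t → ‖γ t - P‖ < ε) ∧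
    (∃ δ₀ > (0 : ℝ), ∀ γ : ℝ → E,
      (∀ t : ℝ, 0 ≤ t → HasDerivAt γ (F (γ t)) t) →
      ‖γ 0 - P‖ < δ₀ → Tendsto γ atTop (𝓝 P)) := by
  have decay : ∀ ρ, 0 < ρ → ρ ≤ r → ∃ δ > 0, ∀ γ : ℝ → E,
      (∀ t : ℝ, 0 ≤ t → HasDerivAt γ (F (γ t)) t) → ‖γ 0 - P‖ < δ →
      ∀ t : ℝ, 0 ≤ t → W (γ t) ≤ m * ρ ^ 2 / 2 * Real.exp (-(k / 2) * t) := by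
    intro ρ hρ hρr
    refine ⟨Real.sqrt (m * ρ ^ 2 / 2 / M), by positivity, fun γ hγ h0 t ht => ?_⟩
    have hWγ : ∀ s, 0 ≤ s → HasDerivAt (fun s => W (γ s)) (W' (γ s) (F (γ s))) s :=
      fun s hs => (hW (γ s)).comp_hasDerivAt s (hγ s hs)
    have hB : ∀ s, HasDerivAt (fun s => m * ρ ^ 2 / 2 * Real.exp (-(k / 2) * s))
        (m * ρ ^ 2 / 2 * (Real.exp (-(k / 2) * s) * -(k / 2))) s := fun s => by
      simpa using (((hasDerivAt_id s).const_mul (-(k / 2))).exp).const_mul (m * ρ ^ 2 / 2)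
    refine image_le_of_deriv_right_lt_deriv_boundary (a := 0) (b := t)
      (fun s hs => (hWγ s hs.1).continuousAt.continuousWithinAt)
      (fun s hs => (hWγ s hs.1).hasDerivWithinAt) ?_ hB ?_ ⟨ht, le_rfl⟩
    · have h1 : ‖γ 0 - P‖ ^ 2 < m * ρ ^ 2 / 2 / M :=
        (Real.lt_sqrt (norm_nonneg _)).1 h0
      rw [lt_div_iff₀ hM] at h1
      simpa using (hupp (γ 0)).trans (by linarith)
    · intro s hs heq
      have hexp : Real.exp (-(k / 2) * s) ≤ 1 :=
        Real.exp_le_one_iff.2 (by have := hs.1; have := mul_nonneg hk.le this; linarith)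
      have hpos : 0 < m * ρ ^ 2 / 2 * Real.exp (-(k / 2) * s) := by positivity
      have hlt : ‖γ s - P‖ < ρ := by
        refine lt_of_pow_lt_pow_left₀ 2 hρ.le (lt_of_mul_lt_mul_left ?_ hm.le)
        have h2 := mul_le_mul_of_nonneg_left hexp (show 0 ≤ m * ρ ^ 2 / 2 by positivity)
        have h3 : 0 < m * ρ ^ 2 := by positivity
        linarith [hlow (γ s)]
      have h4 := hdec (γ s) (hlt.trans_le hρr)
      rw [heq] at h4
      have h5 := mul_pos hk hpos
      linarith
  refine ⟨fun ε hε => ?_, ?_⟩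
  · obtain ⟨δ, hδ, h⟩ := decay (min ε r) (lt_min hε hr) (min_le_right _ _)
    refine ⟨δ, hδ, fun γ hγ h0 t ht => ?_⟩
    have hρ : 0 < min ε r := lt_min hε hr
    refine lt_of_lt_of_le (lt_of_pow_lt_pow_left₀ 2 hρ.le (lt_of_mul_lt_mul_left ?_ hm.le))
      (min_le_left ε r)
    have hexp : Real.exp (-(k / 2) * t) ≤ 1 :=
      Real.exp_le_one_iff.2 (by have := mul_nonneg hk.le ht; linarith)
    have h2 := mul_le_mul_of_nonneg_left hexp (show 0 ≤ m * min ε r ^ 2 / 2 by positivity)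
    have h3 : 0 < m * min ε r ^ 2 := by positivity
    linarith [hlow (γ t), h γ hγ h0 t ht]
  · obtain ⟨δ, hδ, h⟩ := decay r hr le_rfl
    refine ⟨δ, hδ, fun γ hγ h0 => ?_⟩
    have hexp : Tendsto (fun t => r ^ 2 / 2 * Real.exp (-(k / 2) * t)) atTop (𝓝 0) := by
      have h1 : Tendsto (fun t : ℝ => -(k / 2) * t) atTop atBot :=
        tendsto_id.const_mul_atTop_of_neg (by linarith)
      simpa using (Real.tendsto_exp_atBot.comp h1).const_mul (r ^ 2 / 2)
    have hsq : Tendsto (fun t => ‖γ t - P‖ ^ 2) atTop (𝓝 0) := by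
      refine squeeze_zero' (Eventually.of_forall fun t => by positivity) ?_ hexp
      filter_upwards [eventually_ge_atTop 0] with t ht
      refine le_of_mul_le_mul_left ?_ hm
      linarith [hlow (γ t), h γ hγ h0 t ht]
    rw [tendsto_iff_norm_sub_tendsto_zero]
    simpa [Real.sqrt_sq (norm_nonneg _)] using hsq.sqrt

/-- A planar equilibrium whose linearization `!![p, q; r, s]` has negative trace and positive
determinant is locally asymptotically stable, if the remainder is quadratically small. -/
theorem asymptotically_stable_of_trace_neg_of_det_pos {F : ℝ × ℝ → ℝ × ℝ} {P : ℝ × ℝ}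
    {p q r s C : ℝ} (hT : p + s < 0) (hD : 0 < p * s - q * r) (hC : 0 ≤ C)
    (h₁ : ∀ x, ‖x - P‖ < 1 → |(F x).1 - (p * (x.1 - P.1) + q * (x.2 - P.2))| ≤
      C * ((x.1 - P.1) ^ 2 + (x.2 - P.2) ^ 2))
    (h₂ : ∀ x, ‖x - P‖ < 1 → |(F x).2 - (r * (x.1 - P.1) + s * (x.2 - P.2))| ≤
      C * ((x.1 - P.1) ^ 2 + (x.2 - P.2) ^ 2)) :
    (∀ ε > (0 : ℝ), ∃ δ > (0 : ℝ), ∀ γ : ℝ → ℝ × ℝ,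
      (∀ t : ℝ, 0 ≤ t → HasDerivAt γ (F (γ t)) t) →
      ‖γ 0 - P‖ < δ → ∀ t : ℝ, 0 ≤ t → ‖γ t - P‖ < ε) ∧
    (∃ δ₀ > (0 : ℝ), ∀ γ : ℝ → ℝ × ℝ,
      (∀ t : ℝ, 0 ≤ t → HasDerivAt γ (F (γ t)) t) →
      ‖γ 0 - P‖ < δ₀ → Filter.Tendsto γ Filter.atTop (nhds P)) := by
  obtain ⟨D, hDdef⟩ : ∃ D, D = p * s - q * r := ⟨_, rfl⟩
  obtain ⟨T, hTdef⟩ : ∃ T, T = p + s := ⟨_, rfl⟩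
  rw [← hDdef] at hD
  rw [← hTdef] at hT
  obtain ⟨α, hα⟩ : ∃ α, α = D + s ^ 2 + r ^ 2 := ⟨_, rfl⟩
  obtain ⟨β, hβ⟩ : ∃ β, β = -(q * s + p * r) := ⟨_, rfl⟩
  obtain ⟨κ, hκ⟩ : ∃ κ, κ = D + q ^ 2 + p ^ 2 := ⟨_, rfl⟩
  obtain ⟨G, hG⟩ : ∃ G, G = |α| + |β| + |κ| + 1 := ⟨_, rfl⟩
  have hGpos : 0 < G := by rw [hG]; positivity
  have hlowsq : ∀ u v : ℝ, D * (u ^ 2 + v ^ 2) ≤ α * u ^ 2 + 2 * β * (u * v) + κ * v ^ 2 := by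
    intro u v
    rw [hα, hβ, hκ]
    linarith [sq_nonneg (s * u - q * v), sq_nonneg (p * v - r * u)]
  have huppsq : ∀ u v : ℝ, α * u ^ 2 + 2 * β * (u * v) + κ * v ^ 2 ≤ G * (u ^ 2 + v ^ 2) := by
    intro u v
    have e1 : α * u ^ 2 ≤ |α| * u ^ 2 := by gcongr; exact le_abs_self α
    have e2 : κ * v ^ 2 ≤ |κ| * v ^ 2 := by gcongr; exact le_abs_self κ
    have e3 : β * (2 * (u * v)) ≤ |β| * (u ^ 2 + v ^ 2) := by
      refine (le_abs_self _).trans ?_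
      rw [abs_mul]
      gcongr
      exact abs_le.2 ⟨by linarith [sq_nonneg (u + v)], by linarith [sq_nonneg (u - v)]⟩
    rw [hG]
    linarith [mul_nonneg (abs_nonneg α) (sq_nonneg v), mul_nonneg (abs_nonneg κ) (sq_nonneg u),
      sq_nonneg u, sq_nonneg v]
  have hnorm : ∀ x : ℝ × ℝ, |x.1 - P.1| ≤ ‖x - P‖ ∧ |x.2 - P.2| ≤ ‖x - P‖ := fun x =>
    ⟨norm_fst_le (x - P), norm_snd_le (x - P)⟩
  obtain ⟨ρ, hρ⟩ : ∃ ρ, ρ = -(D * T) / (4 * G * C + 1) := ⟨_, rfl⟩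
  have hDT : 0 < -(D * T) := by linarith [mul_neg_of_pos_of_neg hD hT]
  have hden : 0 < 4 * G * C + 1 := by positivity
  have hρpos : 0 < ρ := by rw [hρ]; positivity
  refine asymptotically_stable_of_lyapunov
    (W := fun x => α * (x.1 - P.1) ^ 2 + 2 * β * ((x.1 - P.1) * (x.2 - P.2))
      + κ * (x.2 - P.2) ^ 2)
    (W' := fun x => (2 * (α * (x.1 - P.1) + β * (x.2 - P.2))) • ContinuousLinearMap.fst ℝ ℝ ℝ
      + (2 * (β * (x.1 - P.1) + κ * (x.2 - P.2))) • ContinuousLinearMap.snd ℝ ℝ ℝ)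
    (m := D) (M := 2 * G) (k := -(D * T) / G) (r := min 1 ρ)
    hD (by positivity) (by positivity) (by positivity) ?_ ?_ ?_ ?_
  · intro x
    have hu : HasFDerivAt (fun x : ℝ × ℝ => x.1 - P.1) (ContinuousLinearMap.fst ℝ ℝ ℝ) x :=
      hasFDerivAt_fst.sub_const _
    have hv : HasFDerivAt (fun x : ℝ × ℝ => x.2 - P.2) (ContinuousLinearMap.snd ℝ ℝ ℝ) x :=
      hasFDerivAt_snd.sub_const _
    refine ((((hu.pow 2).const_mul α).add ((hu.mul hv).const_mul (2 * β))).add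
      ((hv.pow 2).const_mul κ)).congr_fderiv ?_
    ext <;> simp <;> ring
  · intro x
    refine le_trans ?_ (hlowsq _ _)
    gcongr
    rcases max_choice ‖(x - P).1‖ ‖(x - P).2‖ with h | h <;>
      rw [Prod.norm_def, h, Real.norm_eq_abs, sq_abs] <;>
      simp [sq_nonneg]
  · intro x
    refine (huppsq _ _).trans ?_
    have e1 : (x.1 - P.1) ^ 2 ≤ ‖x - P‖ ^ 2 := by
      rw [← sq_abs]; gcongr; exact (hnorm x).1
    have e2 : (x.2 - P.2) ^ 2 ≤ ‖x - P‖ ^ 2 := by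
      rw [← sq_abs]; gcongr; exact (hnorm x).2
    rw [show 2 * G * ‖x - P‖ ^ 2 = G * (‖x - P‖ ^ 2 + ‖x - P‖ ^ 2) by ring]
    gcongr
  · intro x hx
    have hx1 : ‖x - P‖ < 1 := hx.trans_le (min_le_left _ _)
    have hxρ : ‖x - P‖ ≤ ρ := (hx.trans_le (min_le_right _ _)).le
    have hu := (hnorm x).1.trans hxρ
    have hv := (hnorm x).2.trans hxρ
    have hN₁ := h₁ x hx1
    have hN₂ := h₂ x hx1
    simp only [add_apply, smul_apply, ContinuousLinearMap.coe_fst',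
      ContinuousLinearMap.coe_snd', smul_eq_mul]
    have hW := huppsq (x.1 - P.1) (x.2 - P.2)
    generalize x.1 - P.1 = u at *
    generalize x.2 - P.2 = v at *
    obtain ⟨N₁, e₁⟩ : ∃ N, N = (F x).1 - (p * u + q * v) := ⟨_, rfl⟩
    obtain ⟨N₂, e₂⟩ : ∃ N, N = (F x).2 - (r * u + s * v) := ⟨_, rfl⟩
    rw [← e₁] at hN₁
    rw [← e₂] at hN₂
    have hlin : ∀ y z, |y| + |z| ≤ G → |y * u + z * v| ≤ G * ρ := fun y z hyz =>
      calc |y * u + z * v| ≤ |y| * |u| + |z| * |v| := by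
            simpa only [abs_mul] using abs_add_le (y * u) (z * v)
        _ ≤ |y| * ρ + |z| * ρ := by gcongr
        _ = (|y| + |z|) * ρ := by ring
        _ ≤ G * ρ := by gcongr
    have hrem : ∀ y N, |y| ≤ G * ρ → |N| ≤ C * (u ^ 2 + v ^ 2) →
        y * N ≤ G * ρ * (C * (u ^ 2 + v ^ 2)) := fun y N hy hN =>
      (le_abs_self _).trans (by rw [abs_mul]; gcongr)
    have r₁ := hrem _ _ (hlin α β (by rw [hG]; linarith [abs_nonneg κ])) hN₁
    have r₂ := hrem _ _ (hlin β κ (by rw [hG]; linarith [abs_nonneg α])) hN₂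
    have hρC : 4 * G * C * ρ ≤ -(D * T) := by
      have : ρ * (4 * G * C + 1) = -(D * T) := by rw [hρ]; field_simp
      linarith
    have hρn := mul_le_mul_of_nonneg_right hρC (show 0 ≤ u ^ 2 + v ^ 2 by positivity)
    have hWn := mul_le_mul_of_nonneg_left hW (show 0 ≤ -(D * T) / G by positivity)
    have hcancel : -(D * T) / G * (G * (u ^ 2 + v ^ 2)) = -(D * T) * (u ^ 2 + v ^ 2) := by
      field_simp
    have hkey : 2 * (α * u + β * v) * (F x).1 + 2 * (β * u + κ * v) * (F x).2 =
        2 * (D * T) * (u ^ 2 + v ^ 2) + 2 * ((α * u + β * v) * N₁) +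
          2 * ((β * u + κ * v) * N₂) := by
      rw [e₁, e₂, hα, hβ, hκ, hDdef, hTdef]
      ring
    rw [hkey]
    linarith

/-- On `B`, the trace of the linearization at the equilibrium is negative. -/
theorem trace_neg_of_mem_paramSetB {a b : ℝ} (hB : (a, b) ∈ paramSetB) :
    0 < a ∧ 0 < b ∧ 3 * (a / 5) ^ 2 - 5 + -(b * (a / 5)) < 0 := by
  have h53 : Real.sqrt (5 / 3) ^ 2 = 5 / 3 := Real.sq_sqrt (by norm_num)
  have hs : 0 < Real.sqrt (5 / 3) := by positivity
  rcases hB with ⟨ha, hle, hb⟩ | ⟨hlt, hb⟩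
  · simp only at ha hle hb
    have h1 : a ^ 2 ≤ (5 * Real.sqrt (5 / 3)) ^ 2 := by gcongr
    have h2 := mul_pos ha hb
    exact ⟨ha, hb, by linarith⟩
  · simp only at hlt hb
    have ha : 0 < a := by linarith
    have h1 : (5 * Real.sqrt (5 / 3)) ^ 2 < a ^ 2 := by gcongr
    have h2 : 0 < (3 * a ^ 2 - 125) / (5 * a) := div_pos (by linarith) (by linarith)
    have h3 := (div_lt_iff₀ (by linarith)).1 hb
    exact ⟨ha, h2.trans hb, by linarith⟩

/-- If `(a, b) ∈ B` then the equilibrium `P_a` is locally asymptotically stable: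
(i) Lyapunov stability and (ii) local attractivity. -/
theorem lengyelEpstein_locally_asymptotically_stable (a b : ℝ)
    (hB : (a, b) ∈ paramSetB) :
    (∀ ε > (0 : ℝ), ∃ δ > (0 : ℝ), ∀ γ : ℝ → ℝ × ℝ,
      (∀ t : ℝ, 0 ≤ t → HasDerivAt γ (lengyelEpstein a b (γ t)) t) →
      ‖γ 0 - lengyelEpsteinEq a‖ < δ →
      ∀ t : ℝ, 0 ≤ t → ‖γ t - lengyelEpsteinEq a‖ < ε) ∧
    (∃ δ₀ > (0 : ℝ), ∀ γ : ℝ → ℝ × ℝ,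
      (∀ t : ℝ, 0 ≤ t → HasDerivAt γ (lengyelEpstein a b (γ t)) t) →
      ‖γ 0 - lengyelEpsteinEq a‖ < δ₀ →
      Filter.Tendsto γ Filter.atTop (nhds (lengyelEpsteinEq a))) := by
  obtain ⟨ha, hb, htr⟩ := trace_neg_of_mem_paramSetB hB
  obtain ⟨c, rfl⟩ : ∃ c, a = 5 * c := ⟨a / 5, by ring⟩
  have hc : 0 < c := by linarith
  have hP : lengyelEpsteinEq (5 * c) = (c, 1 + c ^ 2) := by
    ext <;> simp only [lengyelEpsteinEq] <;> ring
  rw [hP]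
  have hsmall : ∀ x : ℝ × ℝ, ‖x - (c, 1 + c ^ 2)‖ < 1 → |x.1 - c| ≤ 1 := fun x hx =>
    (norm_fst_le (x - (c, 1 + c ^ 2))).trans hx.le
  have hquad : ∀ A B E u v : ℝ, |u| ≤ 1 →
      |A * u ^ 2 + B * (u ^ 2 * u) + E * (u * v)| ≤ (|A| + |B| + |E|) * (u ^ 2 + v ^ 2) := by
    intro A B E u v hu
    have h1 : |u ^ 2| ≤ u ^ 2 + v ^ 2 := by
      rw [abs_of_nonneg (sq_nonneg u)]; linarith [sq_nonneg v]
    have h2 : |u ^ 2 * u| ≤ u ^ 2 + v ^ 2 := by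
      rw [abs_mul]
      exact (mul_le_of_le_one_right (abs_nonneg _) hu).trans h1
    have h3 : |u * v| ≤ u ^ 2 + v ^ 2 :=
      abs_le.2 ⟨by linarith [sq_nonneg (u + v), sq_nonneg u, sq_nonneg v],
        by linarith [sq_nonneg (u - v), sq_nonneg u, sq_nonneg v]⟩
    calc _ ≤ |A| * |u ^ 2| + |B| * |u ^ 2 * u| + |E| * |u * v| := by
          rw [← abs_mul, ← abs_mul, ← abs_mul]
          exact abs_add_three _ _ _
      _ ≤ |A| * (u ^ 2 + v ^ 2) + |B| * (u ^ 2 + v ^ 2) + |E| * (u ^ 2 + v ^ 2) := by gcongr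
      _ = _ := by ring
  refine asymptotically_stable_of_trace_neg_of_det_pos
    (p := 3 * c ^ 2 - 5) (q := -4 * c) (r := 2 * b * c ^ 2) (s := -(b * c))
    (C := (|2 * c| + |-1| + |-4|) + (|3 * b * c| + |b| + |-b|)) ?_ ?_ (by positivity) ?_ ?_
  · have h5 : 5 * c / 5 = c := by ring
    rwa [h5] at htr
  · have h : 0 < 5 * (b * c) * (c ^ 2 + 1) := by positivity
    linarith
  · intro x hx
    refine le_trans (le_of_eq ?_) ((hquad (2 * c) (-1) (-4) (x.1 - c) (x.2 - (1 + c ^ 2))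
      (hsmall x hx)).trans (mul_le_mul_of_nonneg_right
        (le_add_of_nonneg_right (by positivity)) (by positivity)))
    simp only [lengyelEpstein]
    congr 1
    ring
  · intro x hx
    refine le_trans (le_of_eq ?_) ((hquad (3 * b * c) b (-b) (x.1 - c) (x.2 - (1 + c ^ 2))
      (hsmall x hx)).trans (mul_le_mul_of_nonneg_right
        (le_add_of_nonneg_left (by positivity)) (by positivity)))
    simp only [lengyelEpstein]
    congr 1
    ring
end

section
/- If (a, b) ∈ A, then the basin of attraction of the equilibrium P_a = (a/5, 1 + a²/25) of the Lengyel–Epstein vector field F_{a,b} contains the open half-plane {(x, y) ∈ ℝ² : x > 0}: every solution γ : [0, ∞) → ℝ² of γ'(t) = F_{a,b}(γ(t)) whose initial point γ(0) has positive first coordinate satisfies γ(t) → P_a as t → ∞. -/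
/-- The parameter set `A`, where `a^(1/3)` is the real cube root. -/
noncomputable def paramSetA : Set (ℝ × ℝ) :=
  {p | 0 < p.1 ∧ p.1 ≤ 3 * Real.sqrt 3 ∧ 0 < p.2} ∪
  {p | 3 * Real.sqrt 3 < p.1 ∧ p.1 - 3 * p.1 ^ ((1 : ℝ) / 3) < p.2}

/-- A function whose derivative has the sign of `s - c` on a convex set is minimal at `c`. -/
theorem le_of_hasDerivAt_mul_sub_nonneg {f f' : ℝ → ℝ} {D : Set ℝ} (hD : Convex ℝ D)
    (hf : ∀ s ∈ D, HasDerivAt f (f' s) s) {c x : ℝ} (hc : c ∈ D) (hx : x ∈ D)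
    (hsign : ∀ s ∈ D, 0 ≤ (s - c) * f' s) : f c ≤ f x := by
  have hsub := hD.ordConnected
  rcases lt_trichotomy c x with h | h | h
  · obtain ⟨s, hs, hs'⟩ := exists_hasDerivAt_eq_slope f f' h
      (fun s hs => (hf s (hsub.out hc hx hs)).continuousAt.continuousWithinAt)
      (fun s hs => hf s (hsub.out hc hx (Set.Ioo_subset_Icc_self hs)))
    have h1 := hsign s (hsub.out hc hx (Set.Ioo_subset_Icc_self hs))
    have h2 : 0 ≤ f' s := nonneg_of_mul_nonneg_right h1 (sub_pos.2 hs.1)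
    rw [hs'] at h2
    have h3 := mul_nonneg h2 (sub_pos.2 h).le
    rw [div_mul_cancel₀ _ (sub_pos.2 h).ne'] at h3
    linarith
  · rw [h]
  · obtain ⟨s, hs, hs'⟩ := exists_hasDerivAt_eq_slope f f' h
      (fun s hs => (hf s (hsub.out hx hc hs)).continuousAt.continuousWithinAt)
      (fun s hs => hf s (hsub.out hx hc (Set.Ioo_subset_Icc_self hs)))
    have h1 := hsign s (hsub.out hx hc (Set.Ioo_subset_Icc_self hs))
    have h2 : f' s ≤ 0 := by
      by_contra! h2
      have := mul_neg_of_neg_of_pos (sub_neg.2 hs.2) h2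
      linarith
    rw [hs'] at h2
    have h3 := mul_nonneg (neg_nonneg.2 h2) (sub_pos.2 h).le
    rw [neg_mul, div_mul_cancel₀ _ (sub_pos.2 h).ne'] at h3
    linarith

/-- If `w' ≤ 0` on `[0, ∞)` then `w ≤ w 0` there. -/
theorem le_initial_of_hasDerivAt_nonpos {w w' : ℝ → ℝ}
    (hw : ∀ t, 0 ≤ t → HasDerivAt w (w' t) t) (hle : ∀ t, 0 ≤ t → w' t ≤ 0) {t : ℝ}
    (ht : 0 ≤ t) : w t ≤ w 0 := by
  refine antitoneOn_of_deriv_nonpos (convex_Ici (0 : ℝ))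
    (fun s hs => (hw s hs).continuousAt.continuousWithinAt) (fun s hs => ?_) (fun s hs => ?_)
    Set.self_mem_Ici ht ht
  · rw [interior_Ici] at hs
    exact (hw s (le_of_lt hs)).differentiableAt.differentiableWithinAt
  · rw [interior_Ici] at hs
    rw [(hw s (le_of_lt hs)).deriv]
    exact hle s (le_of_lt hs)

/-- A nonnegative function with `w' ≤ -k w` on `[0, ∞)`, `k > 0`, tends to zero. -/
theorem tendsto_zero_of_hasDerivAt_le_neg_mul {w w' : ℝ → ℝ} {k : ℝ} (hk : 0 < k)
    (hw : ∀ t, 0 ≤ t → HasDerivAt w (w' t) t) (hle : ∀ t, 0 ≤ t → w' t ≤ -k * w t)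
    (hnonneg : ∀ t, 0 ≤ t → 0 ≤ w t) : Filter.Tendsto w Filter.atTop (nhds 0) := by
  have hexp : ∀ t, HasDerivAt (fun s : ℝ => Real.exp (k * s)) (Real.exp (k * t) * k) t :=
      fun t => by
    simpa using ((hasDerivAt_id t).const_mul k).exp
  have hbound : ∀ t, 0 ≤ t → w t ≤ w 0 * Real.exp (-(k * t)) := fun t ht => by
    have h := le_initial_of_hasDerivAt_nonpos (fun t ht => (hw t ht).mul (hexp t))
      (fun t ht => by
        have := mul_le_mul_of_nonneg_right (hle t ht) (Real.exp_pos (k * t)).le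
        linarith) ht
    simp only [Pi.mul_apply, mul_zero, Real.exp_zero, mul_one] at h
    rw [Real.exp_neg, ← div_eq_mul_inv, le_div_iff₀ (Real.exp_pos _)]
    exact h
  have hlim : Filter.Tendsto (fun t : ℝ => w 0 * Real.exp (-(k * t))) Filter.atTop (nhds 0) := by
    simpa using (Real.tendsto_exp_neg_atTop_nhds_zero.comp
      (Filter.tendsto_id.const_mul_atTop hk)).const_mul (w 0)
  refine tendsto_of_tendsto_of_tendsto_of_le_of_le' tendsto_const_nhds hlim ?_ ?_
  · filter_upwards [Filter.eventually_ge_atTop (0 : ℝ)] with t ht using hnonneg t ht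
  · filter_upwards [Filter.eventually_ge_atTop (0 : ℝ)] with t ht using hbound t ht

/-- A function that starts positive and has positive derivative at each of its zeros stays
positive. -/
theorem pos_of_hasDerivAt_pos_of_eq_zero {x x' : ℝ → ℝ}
    (hx : ∀ t, 0 ≤ t → HasDerivAt x (x' t) t) (h0 : 0 < x 0)
    (hzero : ∀ t, 0 ≤ t → x t = 0 → 0 < x' t) {t : ℝ} (ht : 0 ≤ t) : 0 < x t := by
  have hnonneg : ∀ s, 0 ≤ s → 0 ≤ x s := fun s hs => by
    have h := image_le_of_deriv_right_lt_deriv_boundary (f := fun s => -x s)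
      (f' := fun s => -x' s) (a := 0) (b := s) (B := fun _ => 0) (B' := fun _ => 0)
      (fun r hr => (hx r hr.1).neg.continuousAt.continuousWithinAt)
      (fun r hr => (hx r hr.1).neg.hasDerivWithinAt) (by linarith)
      (fun r => hasDerivAt_const r 0)
      (fun r hr h => by linarith [hzero r hr.1 (neg_eq_zero.1 h)]) ⟨hs, le_rfl⟩
    linarith
  rcases (hnonneg t ht).lt_or_eq with h | h
  · exact h
  · have htpos : 0 < t := by
      rcases ht.lt_or_eq with h' | h'
      · exact h'
      · rw [← h'] at h
        exact absurd h h0.ne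
    have hmin : IsLocalMin x t := by
      filter_upwards [lt_mem_nhds htpos] with s hs
      rw [← h]
      exact hnonneg s hs.le
    exact absurd (hmin.hasDerivAt_eq_zero (hx t ht)).symm (hzero t ht h.symm).ne

/-- On `A` the damping coefficient `b - a + 2 x + a / x ^ 2` is bounded below by a positive
constant for `x > 0`. -/
theorem exists_pos_le_damping {a b : ℝ} (hA : (a, b) ∈ paramSetA) :
    0 < a ∧ 0 < b ∧ ∃ δ > 0, ∀ x > 0, δ ≤ b - a + 2 * x + a / x ^ 2 := by
  have hs : Real.sqrt 3 ^ 2 = 3 := Real.sq_sqrt (by norm_num)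
  have hs0 : 0 < Real.sqrt 3 := Real.sqrt_pos.2 (by norm_num)
  have ha : 0 < a := by
    rcases hA with h | h
    · exact h.1
    · have := h.1
      simp only at this
      linarith
  obtain ⟨c, hc, hc0, hca⟩ : ∃ c, c = a ^ ((1 : ℝ) / 3) ∧ 0 < c ∧ c ^ 3 = a := by
    refine ⟨_, rfl, Real.rpow_pos_of_pos ha _, ?_⟩
    rw [← Real.rpow_natCast, ← Real.rpow_mul ha.le]
    norm_num
  have key : ∀ x > 0, 3 * c ≤ 2 * x + a / x ^ 2 := fun x hx => by
    have h : 2 * x + a / x ^ 2 - 3 * c = (x - c) ^ 2 * (2 * x + c) / x ^ 2 := by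
      rw [← hca]
      field_simp
      ring
    have : 0 ≤ (x - c) ^ 2 * (2 * x + c) / x ^ 2 := by positivity
    linarith
  rcases hA with ⟨-, h1, h2⟩ | ⟨h1, h2⟩
  · simp only at h1 h2
    refine ⟨ha, h2, b, h2, fun x hx => ?_⟩
    have hcs : c ≤ Real.sqrt 3 := by
      by_contra! h
      have := pow_lt_pow_left₀ h hs0.le (n := 3) (by norm_num)
      nlinarith
    have : c ^ 2 ≤ 3 := by nlinarith
    have := key x hx
    nlinarith
  · simp only at h1 h2
    rw [← hc] at h2
    have hcs : Real.sqrt 3 < c := by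
      by_contra! h
      have := pow_le_pow_left₀ hc0.le h 3
      nlinarith
    have : 3 < c ^ 2 := by nlinarith
    refine ⟨ha, by nlinarith, b - a + 3 * c, by linarith, fun x hx => ?_⟩
    have := key x hx
    linarith

/-- The potential of the Liénard form of the system, normalised to have critical point `c`. -/
noncomputable def lienardPotential (c s : ℝ) : ℝ :=
  s + s ^ 3 / 3 - c * Real.log s - c * s ^ 2 / 2

theorem hasDerivAt_lienardPotential (c : ℝ) {s : ℝ} (hs : 0 < s) :
    HasDerivAt (lienardPotential c) ((s - c) * (1 + s ^ 2) / s) s := by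
  have h := (((hasDerivAt_id s).add ((hasDerivAt_pow 3 s).div_const 3)).sub
    ((Real.hasDerivAt_log hs.ne').const_mul c)).sub
    (((hasDerivAt_pow 2 s).const_mul c).div_const 2)
  refine h.congr_deriv ?_
  field_simp
  ring

theorem sq_le_lienardPotential_sub {c s : ℝ} (hc : 0 < c) (hs : 0 < s) :
    (s - c) ^ 2 ≤ lienardPotential c s - lienardPotential c c := by
  have h := le_of_hasDerivAt_mul_sub_nonneg (convex_Ioi (0 : ℝ))
    (f := fun s => lienardPotential c s - (s - c) ^ 2)
    (fun r hr => (hasDerivAt_lienardPotential c hr).sub (((hasDerivAt_id r).sub_const c).pow 2))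
    (Set.mem_Ioi.2 hc) (Set.mem_Ioi.2 hs) (fun r hr => by
      have hr' : (0 : ℝ) < r := hr
      have : (r - c) * ((r - c) * (1 + r ^ 2) / r - ((2 : ℕ) : ℝ) * (id r - c) ^ (2 - 1) * 1)
          = (r - c) ^ 2 * (r - 1) ^ 2 / r := by
        simp only [id]
        field_simp
        ring
      rw [this]
      positivity)
  simp only [sub_self] at h
  linarith

theorem lienardPotential_sub_le {c s m M : ℝ} (hm : 0 < m) (hc : c ∈ Set.Icc m M)
    (hs : s ∈ Set.Icc m M) :
    lienardPotential c s - lienardPotential c c ≤ (1 / m + M) * (s - c) ^ 2 := by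
  have h := le_of_hasDerivAt_mul_sub_nonneg (convex_Icc m M)
    (f := fun s => (1 / m + M) * (s - c) ^ 2 - lienardPotential c s)
    (fun r hr => ((((hasDerivAt_id r).sub_const c).pow 2).const_mul (1 / m + M)).sub
      (hasDerivAt_lienardPotential c (hm.trans_le hr.1)))
    hc hs (fun r hr => by
      have hr' : (0 : ℝ) < r := hm.trans_le hr.1
      have : (r - c) * ((1 / m + M) * (((2 : ℕ) : ℝ) * (id r - c) ^ (2 - 1) * 1) -
          (r - c) * (1 + r ^ 2) / r) = (r - c) ^ 2 * (2 * (1 / m + M) - (1 / r + r)) := by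
        simp only [id]
        field_simp
        ring
      rw [this]
      have h1 : 1 / r ≤ 1 / m := one_div_le_one_div_of_le hm hr.1
      have h2 : 0 < 1 / m := by positivity
      have h3 := hr.2
      exact mul_nonneg (sq_nonneg _) (by linarith))
  simp only [sub_self] at h
  linarith

/-- Sublevel sets of the potential are bounded and bounded away from zero. -/
theorem exists_Icc_of_lienardPotential_sub_le {c : ℝ} (hc : 0 < c) (C : ℝ) :
    ∃ m M, 0 < m ∧ c ∈ Set.Icc m M ∧ ∀ s, 0 < s →
      lienardPotential c s - lienardPotential c c ≤ C → s ∈ Set.Icc m M := by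
  set M := c + C + 1 with hM
  set B := (C + lienardPotential c c + c * M ^ 2 / 2) / c with hB
  refine ⟨min c (Real.exp (-B)), max c M, lt_min hc (Real.exp_pos _),
    ⟨min_le_left _ _, le_max_left _ _⟩, fun s hs hle => ?_⟩
  have hsq := sq_le_lienardPotential_sub hc hs
  have hsM : s ≤ M := by nlinarith [sq_nonneg (s - c - 1)]
  refine ⟨(min_le_right _ _).trans ?_, hsM.trans (le_max_right _ _)⟩
  rw [← Real.le_log_iff_exp_le hs, neg_le, hB, le_div_iff₀ hc]
  have h1 : s ^ 2 ≤ M ^ 2 := pow_le_pow_left₀ hs.le hsM 2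
  have h2 : c * s ^ 2 ≤ c * M ^ 2 := mul_le_mul_of_nonneg_left h1 hc.le
  have h3 : 0 < s ^ 3 := by positivity
  unfold lienardPotential at hle ⊢
  linarith

/-- Global asymptotic stability for the damped Liénard system `x' = x u`,
`u' = x (-d u - 5 b p(x))`, where `p` is the derivative of `lienardPotential c`. -/
theorem lienard_tendsto {b c δ : ℝ} {d : ℝ → ℝ} {x u : ℝ → ℝ} (hb : 0 < b) (hc : 0 < c)
    (hδ : 0 < δ) (hd : ∀ s > 0, δ ≤ d s) (hdc : ContinuousOn d (Set.Ioi 0))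
    (hxpos : ∀ t, 0 ≤ t → 0 < x t)
    (hx : ∀ t, 0 ≤ t → HasDerivAt x (x t * u t) t)
    (hu : ∀ t, 0 ≤ t → HasDerivAt u
      (x t * (-d (x t) * u t - 5 * b * ((x t - c) * (1 + x t ^ 2) / x t))) t) :
    Filter.Tendsto x Filter.atTop (nhds c) ∧ Filter.Tendsto u Filter.atTop (nhds 0) := by
  have hV : ∀ t, 0 ≤ t → HasDerivAt
      (fun t => u t ^ 2 / 2 + 5 * b * (lienardPotential c (x t) - lienardPotential c c))
      (-(x t * d (x t) * u t ^ 2)) t := fun t ht => by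
    have hH : HasDerivAt (fun t => lienardPotential c (x t)) _ t :=
      (hasDerivAt_lienardPotential c (hxpos t ht)).comp t (hx t ht)
    refine ((((hu t ht).pow 2).div_const 2).add
      ((hH.sub_const (lienardPotential c c)).const_mul (5 * b))).congr_deriv ?_
    push_cast
    ring
  set V := fun t => u t ^ 2 / 2 + 5 * b * (lienardPotential c (x t) - lienardPotential c c)
    with hVdef
  have hVle : ∀ t, 0 ≤ t → V t ≤ V 0 := fun t ht =>
    le_initial_of_hasDerivAt_nonpos hV (fun t ht => by
      have h1 := hxpos t ht
      have h2 := hδ.trans_le (hd _ h1)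
      have : 0 ≤ x t * d (x t) * u t ^ 2 := by positivity
      linarith) ht
  obtain ⟨m, M, hm, hcm, hmM⟩ := exists_Icc_of_lienardPotential_sub_le hc (V 0 / (5 * b))
  have hxm : ∀ t, 0 ≤ t → x t ∈ Set.Icc m M := fun t ht => by
    refine hmM _ (hxpos t ht) ?_
    rw [le_div_iff₀ (by positivity)]
    have h1 := hVle t ht
    have h2 : V t = u t ^ 2 / 2 + 5 * b * (lienardPotential c (x t) - lienardPotential c c) := rfl
    nlinarith [sq_nonneg (u t)]
  obtain ⟨L, hL⟩ := (isCompact_Icc (a := m) (b := M)).bddAbove_image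
    (hdc.mono fun s hs => hm.trans_le hs.1)
  have hdL : ∀ s ∈ Set.Icc m M, d s ≤ L := fun s hs => hL ⟨s, hs, rfl⟩
  have hL0 : 0 < L := (hδ.trans_le (hd c hc)).trans_le (hdL c hcm)
  obtain ⟨ε, hε, hε1, hε2, hε3⟩ : ∃ ε > 0, ε ≤ 1 / 2 ∧ ε ≤ 5 * b ∧
      ε * (1 + L ^ 2 / (20 * b)) ≤ δ / 2 := by
    refine ⟨min (min (1 / 2) (5 * b)) (δ / 2 / (1 + L ^ 2 / (20 * b))), ?_, ?_, ?_, ?_⟩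
    · positivity
    · exact (min_le_left _ _).trans (min_le_left _ _)
    · exact (min_le_left _ _).trans (min_le_right _ _)
    · rw [← le_div_iff₀ (by positivity)]
      exact min_le_right _ _
  set q := fun t => u t ^ 2 + (x t - c) ^ 2 with hq
  have hW : ∀ t, 0 ≤ t → HasDerivAt (fun t => V t + ε * (u t * (x t - c)))
      (x t * (-(d (x t) - ε) * u t ^ 2 - ε * d (x t) * u t * (x t - c)
        - 5 * b * ε * ((x t - c) ^ 2 * ((1 + x t ^ 2) / x t)))) t := fun t ht => by
    refine ((hV t ht).add (((hu t ht).mul ((hx t ht).sub_const c)).const_mul ε)).congr_deriv ?_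
    ring
  set κ := min (δ / 2) (5 * b * ε) with hκ
  have hκ0 : 0 < κ := by positivity
  have hWd : ∀ t, 0 ≤ t → x t * (-(d (x t) - ε) * u t ^ 2 - ε * d (x t) * u t * (x t - c)
        - 5 * b * ε * ((x t - c) ^ 2 * ((1 + x t ^ 2) / x t))) ≤ -(m * κ) * q t := fun t ht => by
    have hx0 := hxpos t ht
    have h2 : 2 ≤ (1 + x t ^ 2) / x t := by
      rw [le_div_iff₀ hx0]
      nlinarith [sq_nonneg (x t - 1)]
    have hd1 := hd _ hx0
    have hd2 := hdL _ (hxm t ht)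
    have hdsq : d (x t) ^ 2 ≤ L ^ 2 := pow_le_pow_left₀ (hδ.trans_le hd1).le hd2 2
    have hyoung : -(d (x t) * u t * (x t - c)) ≤
        5 * b * (x t - c) ^ 2 + L ^ 2 / (20 * b) * u t ^ 2 := by
      have h3 : 0 ≤ (10 * b * (x t - c) + d (x t) * u t) ^ 2 / (20 * b) := by positivity
      have h4 : (10 * b * (x t - c) + d (x t) * u t) ^ 2 / (20 * b) =
          5 * b * (x t - c) ^ 2 + d (x t) * u t * (x t - c)
            + d (x t) ^ 2 / (20 * b) * u t ^ 2 := by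
        field_simp
        ring
      have h5 : d (x t) ^ 2 / (20 * b) * u t ^ 2 ≤ L ^ 2 / (20 * b) * u t ^ 2 := by gcongr
      linarith
    have h3 := mul_le_mul_of_nonneg_left hyoung hε.le
    have h4 : (x t - c) ^ 2 * 2 ≤ (x t - c) ^ 2 * ((1 + x t ^ 2) / x t) :=
      mul_le_mul_of_nonneg_left h2 (sq_nonneg _)
    have h5 := mul_le_mul_of_nonneg_left h4 (show 0 ≤ 5 * b * ε by positivity)
    have h6 := mul_le_mul_of_nonneg_right hε3 (sq_nonneg (u t))
    have h7 := mul_le_mul_of_nonneg_right hd1 (sq_nonneg (u t))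
    have h8 := mul_le_mul_of_nonneg_right (min_le_left (δ / 2) (5 * b * ε)) (sq_nonneg (u t))
    have h9 := mul_le_mul_of_nonneg_right (min_le_right (δ / 2) (5 * b * ε)) (sq_nonneg (x t - c))
    have h10 : -(d (x t) - ε) * u t ^ 2 - ε * d (x t) * u t * (x t - c)
        - 5 * b * ε * ((x t - c) ^ 2 * ((1 + x t ^ 2) / x t)) ≤ -(κ * q t) := by
      simp only [hq, hκ]
      linarith
    have hq0 : 0 ≤ κ * q t := by simp only [hq]; positivity
    have h11 := mul_le_mul_of_nonneg_left h10 hx0.le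
    have h12 := mul_le_mul_of_nonneg_right (hxm t ht).1 hq0
    linarith
  have hcross : ∀ t, |u t * (x t - c)| ≤ q t / 2 := fun t => by
    simp only [hq]
    rw [abs_le]
    constructor <;> nlinarith [sq_nonneg (u t + (x t - c)), sq_nonneg (u t - (x t - c))]
  set ρ := min (1 / 4 : ℝ) (5 * b / 2) with hρ
  have hρ0 : 0 < ρ := by positivity
  have hlow : ∀ t, 0 ≤ t → ρ * q t ≤ V t + ε * (u t * (x t - c)) := fun t ht => by
    have h1 := mul_le_mul_of_nonneg_left (neg_le_of_abs_le (hcross t)) hε.le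
    have h2 := mul_le_mul_of_nonneg_left (sq_le_lienardPotential_sub hc (hxpos t ht))
      (show 0 ≤ 5 * b by positivity)
    have h3 := mul_le_mul_of_nonneg_right hε1 (sq_nonneg (u t))
    have h4 := mul_le_mul_of_nonneg_right hε2 (sq_nonneg (x t - c))
    have h5 := mul_le_mul_of_nonneg_right (min_le_left (1 / 4 : ℝ) (5 * b / 2)) (sq_nonneg (u t))
    have h6 := mul_le_mul_of_nonneg_right (min_le_right (1 / 4 : ℝ) (5 * b / 2))
      (sq_nonneg (x t - c))
    simp only [hq, hVdef, hρ] at h1 ⊢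
    linarith
  have hMpos : 0 < 1 / m + M := by
    have := hc.trans_le hcm.2
    positivity
  set K := 1 + 5 * b * (1 / m + M) with hK
  have hK0 : 0 < K := by positivity
  have hup : ∀ t, 0 ≤ t → V t + ε * (u t * (x t - c)) ≤ K * q t := fun t ht => by
    have h1 := mul_le_mul_of_nonneg_left (le_of_abs_le (hcross t)) hε.le
    have h2 := mul_le_mul_of_nonneg_left (lienardPotential_sub_le hm hcm (hxm t ht))
      (show 0 ≤ 5 * b by positivity)
    have h3 := mul_le_mul_of_nonneg_right hε1 (sq_nonneg (u t))
    have h4 := mul_le_mul_of_nonneg_right hε1 (sq_nonneg (x t - c))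
    have h5 := mul_nonneg (show 0 ≤ 5 * b * (1 / m + M) by positivity) (sq_nonneg (u t))
    have h6 := sq_nonneg (u t)
    have h7 := sq_nonneg (x t - c)
    simp only [hq, hVdef, hK] at h1 ⊢
    linarith
  have hq0 : ∀ t, 0 ≤ q t := fun t => by simp only [hq]; positivity
  have hWlim : Filter.Tendsto (fun t => V t + ε * (u t * (x t - c))) Filter.atTop (nhds 0) := by
    refine tendsto_zero_of_hasDerivAt_le_neg_mul (k := m * κ / K) (by positivity) hW
      (fun t ht => (hWd t ht).trans ?_) (fun t ht => ?_)
    · have h1 := mul_le_mul_of_nonneg_left (hup t ht) (show 0 ≤ m * κ / K by positivity)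
      have h2 : m * κ / K * (K * q t) = m * κ * q t := by field_simp
      linarith
    · exact (mul_nonneg hρ0.le (hq0 t)).trans (hlow t ht)
  have hqlim : Filter.Tendsto q Filter.atTop (nhds 0) := by
    have h : Filter.Tendsto (fun t => ρ⁻¹ * (V t + ε * (u t * (x t - c)))) Filter.atTop
        (nhds 0) := by
      simpa using hWlim.const_mul ρ⁻¹
    refine tendsto_of_tendsto_of_tendsto_of_le_of_le' tendsto_const_nhds h
      (Filter.Eventually.of_forall hq0) ?_
    filter_upwards [Filter.eventually_ge_atTop (0 : ℝ)] with t ht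
    rw [le_inv_mul_iff₀ hρ0]
    exact hlow t ht
  have hsqrt : Filter.Tendsto (fun t => Real.sqrt (q t)) Filter.atTop (nhds 0) := by
    simpa [Function.comp_def] using (Real.continuous_sqrt.tendsto 0).comp hqlim
  constructor
  · rw [tendsto_iff_dist_tendsto_zero]
    refine squeeze_zero (fun _ => dist_nonneg) (fun t => ?_) hsqrt
    rw [Real.dist_eq]
    exact Real.abs_le_sqrt (le_add_of_nonneg_left (sq_nonneg _))
  · refine squeeze_zero_norm (fun t => ?_) hsqrt
    rw [Real.norm_eq_abs]
    exact Real.abs_le_sqrt (le_add_of_nonneg_right (sq_nonneg _))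

/-- If `(a, b) ∈ A` then the basin of attraction of the equilibrium `P_a`
contains the open half-plane `x > 0`: every solution `γ : [0, ∞) → ℝ²` whose
initial point has positive first coordinate converges to `P_a` as `t → ∞`. -/
theorem lengyelEpstein_basin_contains_halfPlane (a b : ℝ)
    (hA : (a, b) ∈ paramSetA) (γ : ℝ → ℝ × ℝ)
    (hγ : ∀ t : ℝ, 0 ≤ t → HasDerivAt γ (lengyelEpstein a b (γ t)) t)
    (h0 : 0 < (γ 0).1) :
    Filter.Tendsto γ Filter.atTop (nhds (lengyelEpsteinEq a)) := by
  obtain ⟨ha, hb, δ, hδ, hdamp⟩ := exists_pos_le_damping hA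
  have hx : ∀ t, 0 ≤ t → HasDerivAt (fun t => (γ t).1)
      ((a - (γ t).1) * (1 + (γ t).1 ^ 2) - 4 * (γ t).1 * (γ t).2) t := fun t ht =>
    (ContinuousLinearMap.fst ℝ ℝ ℝ).hasFDerivAt.comp_hasDerivAt t (hγ t ht)
  have hy : ∀ t, 0 ≤ t → HasDerivAt (fun t => (γ t).2)
      (b * (γ t).1 * (1 + (γ t).1 ^ 2 - (γ t).2)) t := fun t ht =>
    (ContinuousLinearMap.snd ℝ ℝ ℝ).hasFDerivAt.comp_hasDerivAt t (hγ t ht)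
  have hpos : ∀ t, 0 ≤ t → 0 < (γ t).1 := fun t ht =>
    pos_of_hasDerivAt_pos_of_eq_zero hx h0 (fun t _ h => by rw [h]; linarith) ht
  have hfx : ∀ s : ℝ, 0 < s → HasDerivAt (fun s : ℝ => a / s + a * s - 1 - s ^ 2)
      (a - 2 * s - a / s ^ 2) s := fun s hs => by
    refine (((((hasDerivAt_const s a).div (hasDerivAt_id s) hs.ne').add
      ((hasDerivAt_id s).const_mul a)).sub_const 1).sub (hasDerivAt_pow 2 s)).congr_deriv ?_
    simp only [id]
    field_simp
    ring
  obtain ⟨hxlim, hulim⟩ := lienard_tendsto (b := b) (c := a / 5) (δ := δ)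
    (d := fun s => b - a + 2 * s + a / s ^ 2) (x := fun t => (γ t).1)
    (u := fun t => a / (γ t).1 + a * (γ t).1 - 1 - (γ t).1 ^ 2 - 4 * (γ t).2)
    hb (by positivity) hδ hdamp
    (ContinuousOn.add (by fun_prop) (continuousOn_const.div (by fun_prop) fun s hs =>
      pow_ne_zero 2 (ne_of_gt hs))) hpos
    (fun t ht => (hx t ht).congr_deriv (by
      have := (hpos t ht).ne'
      field_simp
      ring))
    (fun t ht => (((hfx _ (hpos t ht)).comp t (hx t ht)).sub
      ((hy t ht).const_mul 4)).congr_deriv (by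
      have := (hpos t ht).ne'
      field_simp
      ring))
  have hylim : Filter.Tendsto (fun t => (γ t).2) Filter.atTop (nhds (1 + a ^ 2 / 25)) := by
    have h :=
      (((hfx (a / 5) (by positivity)).continuousAt.tendsto.comp hxlim).sub hulim).div_const 4
    have he : (a / (a / 5) + a * (a / 5) - 1 - (a / 5) ^ 2 - 0) / 4 = 1 + a ^ 2 / 25 := by
      field_simp
      ring
    rw [he] at h
    refine h.congr fun t => ?_
    simp only [Function.comp]
    ring
  exact hxlim.prodMk_nhds hylim
end

section
/- If (a, b) ∈ A, then the Lengyel–Epstein vector field F_{a,b} has no closed orbits in the open first quadrant: there is no nonconstant periodic solution γ : ℝ → ℝ² of γ'(t) = F_{a,b}(γ(t)) (i.e., a nonconstant solution with γ(t + T) = γ(t) for all t and some T > 0) whose image is contained in Q₁ = {(x, y) ∈ ℝ² : x > 0, y > 0}. -/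
/-- The open first quadrant. -/
def firstQuadrant : Set (ℝ × ℝ) := {p | 0 < p.1 ∧ 0 < p.2}

/-- Membership in `paramSetA` makes the damping coefficient of the Liénard form of the
Lengyel–Epstein system positive; the cleared-denominator version of this fact. -/
theorem damping_pos_of_mem_paramSetA {a b : ℝ} (hA : (a, b) ∈ paramSetA) {x : ℝ} (hx : 0 < x) :
    0 < a + 2 * x ^ 3 + (b - a) * x ^ 2 := by
  have ha : 0 < a := by
    rcases hA with ⟨h, -, -⟩ | ⟨h, -⟩
    · exact h
    · exact lt_trans (by positivity) h
  obtain ⟨c, hc⟩ : ∃ c : ℝ, c = a ^ ((1 : ℝ) / 3) := ⟨_, rfl⟩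
  have hc0 : 0 < c := hc ▸ Real.rpow_pos_of_pos ha _
  have hc3 : c ^ 3 = a := by
    rw [hc, ← Real.rpow_natCast, ← Real.rpow_mul ha.le]
    norm_num
  have hb : a - 3 * c < b := by
    rcases hA with ⟨-, h, hb⟩ | ⟨-, h⟩
    · have h3 : Real.sqrt 3 ^ 2 = 3 := Real.sq_sqrt (by norm_num)
      have hs : c ≤ Real.sqrt 3 := by
        refine le_of_pow_le_pow_left₀ three_ne_zero (Real.sqrt_nonneg 3) ?_
        calc c ^ 3 ≤ 3 * Real.sqrt 3 := hc3 ▸ h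
          _ = Real.sqrt 3 ^ 3 := by rw [pow_succ, h3]
      have hs2 : c ^ 2 ≤ 3 := h3 ▸ pow_le_pow_left₀ hc0.le hs 2
      have : a - 3 * c ≤ 0 := by
        rw [← hc3]
        nlinarith
      exact this.trans_lt hb
    · exact hc ▸ h
  have h1 : 0 < (b - (a - 3 * c)) * x ^ 2 := mul_pos (sub_pos.2 hb) (by positivity)
  have h2 : 0 ≤ (x - c) ^ 2 * (2 * x + c) := by positivity
  have h3 : (x - c) ^ 2 * (2 * x + c) = a + 2 * x ^ 3 - 3 * c * x ^ 2 := by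
    rw [← hc3]
    ring
  linarith

/-- The velocity of the Liénard form of the Lengyel–Epstein system (after dividing the vector
field by `x`). -/
noncomputable def lienardVelocity (a : ℝ) (p : ℝ × ℝ) : ℝ :=
  a / p.1 + a * p.1 - 1 - p.1 ^ 2 - 4 * p.2

/-- The energy of the Liénard form of the Lengyel–Epstein system. -/
noncomputable def lienardEnergy (a b : ℝ) (p : ℝ × ℝ) : ℝ :=
  lienardVelocity a p ^ 2 / 2 +
    b * (5 * p.1 + 5 * p.1 ^ 3 / 3 - a * Real.log p.1 - a * p.1 ^ 2 / 2)

theorem lengyelEpstein_fst (a b : ℝ) {p : ℝ × ℝ} (hp : 0 < p.1) :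
    (lengyelEpstein a b p).1 = p.1 * lienardVelocity a p := by
  simp only [lengyelEpstein, lienardVelocity]
  field_simp
  ring

/-- The energy is dissipated along solutions in the right half-plane. -/
theorem hasDerivAt_lienardEnergy {a b t : ℝ} {γ : ℝ → ℝ × ℝ}
    (hγ : HasDerivAt γ (lengyelEpstein a b (γ t)) t) (hx : 0 < (γ t).1) :
    HasDerivAt (fun s => lienardEnergy a b (γ s))
      (-((a + 2 * (γ t).1 ^ 3 + (b - a) * (γ t).1 ^ 2) / (γ t).1 *
        lienardVelocity a (γ t) ^ 2)) t := by
  have h1 : HasDerivAt (fun s => (γ s).1) (lengyelEpstein a b (γ t)).1 t := hγ.fst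
  have h2 : HasDerivAt (fun s => (γ s).2) (lengyelEpstein a b (γ t)).2 t := hγ.snd
  have hv := ((((h1.fun_inv hx.ne').const_mul a).fun_add (h1.const_mul a)).sub_const 1).fun_sub
    (h1.fun_pow 2) |>.fun_sub (h2.const_mul 4)
  have hE := ((hv.fun_pow 2).div_const 2).fun_add
    (((((h1.const_mul 5).fun_add (((h1.fun_pow 3).const_mul 5).div_const 3)).fun_sub
      ((h1.log hx.ne').const_mul a)).fun_sub
      (((h1.fun_pow 2).const_mul a).div_const 2)).const_mul b)
  simp only [← div_eq_mul_inv] at hE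
  refine hE.congr_deriv ?_
  simp only [lengyelEpstein, lienardVelocity]
  have hx0 := hx.ne'
  generalize (γ t).1 = x at hx0 ⊢
  push_cast
  field_simp
  ring

/-- If `(a, b) ∈ A` then the Lengyel–Epstein system has no closed orbits in the
open first quadrant: there is no nonconstant periodic solution whose image is
contained in `Q₁`. -/
theorem lengyelEpstein_no_closed_orbits (a b : ℝ) (hA : (a, b) ∈ paramSetA) :
    ¬ ∃ (γ : ℝ → ℝ × ℝ) (T : ℝ), 0 < T ∧
      (∀ t : ℝ, HasDerivAt γ (lengyelEpstein a b (γ t)) t) ∧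
      (∀ t : ℝ, γ (t + T) = γ t) ∧
      (∃ t s : ℝ, γ t ≠ γ s) ∧
      (∀ t : ℝ, γ t ∈ firstQuadrant) := by
  rintro ⟨γ, T, hT, hγ, hper, ⟨t₀, s₀, hne⟩, hQ⟩
  have hx : ∀ t, 0 < (γ t).1 := fun t => (hQ t).1
  have hE := fun t => hasDerivAt_lienardEnergy (hγ t) (hx t)
  have hanti : Antitone fun s => lienardEnergy a b (γ s) := by
    refine antitone_of_hasDerivAt_nonpos hE fun t => neg_nonpos.2 ?_
    have := damping_pos_of_mem_paramSetA hA (hx t)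
    have := hx t
    positivity
  have hperE : Function.Periodic (fun s => lienardEnergy a b (γ s)) T := fun t => by
    simp only [hper t]
  have hconst : ∀ t s, lienardEnergy a b (γ t) ≤ lienardEnergy a b (γ s) := fun t s => by
    obtain ⟨n, hn⟩ := exists_nat_ge ((s - t) / T)
    have hle : s ≤ t + n * T := by
      rw [div_le_iff₀ hT] at hn
      linarith
    calc lienardEnergy a b (γ t) = lienardEnergy a b (γ (t + n * T)) := (hperE.nat_mul n t).symm
      _ ≤ lienardEnergy a b (γ s) := hanti hle
  have hv : ∀ t, lienardVelocity a (γ t) = 0 := fun t => by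
    have hc : (fun s => lienardEnergy a b (γ s)) = fun _ => lienardEnergy a b (γ t) :=
      funext fun s => le_antisymm (hconst s t) (hconst t s)
    have h0 := (hE t).unique (hc ▸ hasDerivAt_const t _)
    have hd := div_pos (damping_pos_of_mem_paramSetA hA (hx t)) (hx t)
    simpa [hd.ne'] using neg_eq_zero.1 h0
  have hx' : ∀ t, HasDerivAt (fun s => (γ s).1) 0 t := fun t => by
    have h : HasDerivAt (fun s => (γ s).1) (lengyelEpstein a b (γ t)).1 t := (hγ t).fst
    rwa [lengyelEpstein_fst a b (hx t), hv t, mul_zero] at h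
  have hfst : (γ t₀).1 = (γ s₀).1 :=
    is_const_of_deriv_eq_zero (fun t => (hx' t).differentiableAt) (fun t => (hx' t).deriv) t₀ s₀
  refine hne (Prod.ext hfst ?_)
  have ht := hv t₀
  have hs := hv s₀
  simp only [lienardVelocity, hfst] at ht hs
  linarith
end

section
/- For all parameters a > 0 and b > 0, the open first quadrant Q₁ = {(x, y) ∈ ℝ² : x > 0, y > 0} is positively invariant under the flow of the Lengyel–Epstein vector field F_{a,b}: for every T ∈ (0, ∞] and every solution γ : [0, T) → ℝ² of γ'(t) = F_{a,b}(γ(t)) with γ(0) ∈ Q₁, one has γ(t) ∈ Q₁ for all t ∈ [0, T). -/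
open scoped ENNReal

/-- A function on `[0, t]` that starts positive and has positive derivative at each of its zeros
is positive at `t`. -/
theorem pos_of_deriv_pos_of_eq_zero {f f' : ℝ → ℝ} {t : ℝ} (ht : 0 ≤ t)
    (hf : ∀ s ∈ Set.Icc 0 t, HasDerivAt f (f' s) s) (h0 : 0 < f 0)
    (hzero : ∀ s ∈ Set.Icc 0 t, f s = 0 → 0 < f' s) : 0 < f t := by
  have hnonneg : ∀ ⦃s⦄, s ∈ Set.Icc 0 t → 0 ≤ f s :=
    image_le_of_deriv_right_lt_deriv_boundary' (f := fun _ => (0 : ℝ)) (f' := fun _ => 0)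
      continuousOn_const (fun s _ => hasDerivWithinAt_const s _ 0) h0.le
      (fun s hs => (hf s hs).continuousAt.continuousWithinAt)
      (fun s hs => (hf s (Set.Ico_subset_Icc_self hs)).hasDerivWithinAt)
      (fun s hs h => hzero s (Set.Ico_subset_Icc_self hs) h.symm)
  have htt : t ∈ Set.Icc 0 t := ⟨ht, le_rfl⟩
  refine (hnonneg htt).lt_of_ne' fun hft => ?_
  have htpos : 0 < t := ht.lt_of_ne fun h => h0.ne' (h ▸ hft)
  have hsign := eventually_nhdsWithin_sign_eq_of_deriv_pos
    ((hf t htt).deriv.symm ▸ hzero t htt hft) hft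
  obtain ⟨s, hs, hs0, hst⟩ :=
    ((hsign.filter_mono nhdsWithin_le_nhds).and (Ioo_mem_nhdsLT htpos)).exists
  rw [sign_neg (sub_neg.mpr hst), sign_eq_neg_one_iff] at hs
  exact hs.not_ge (hnonneg ⟨hs0.le, hst.le⟩)

/-- For all `a > 0`, `b > 0`, the open first quadrant is positively invariant
under the flow of the Lengyel–Epstein vector field: any solution
`γ : [0, T) → ℝ²` with `γ 0 ∈ Q₁` remains in `Q₁`. -/
theorem lengyelEpstein_firstQuadrant_positively_invariant (a b : ℝ)
    (ha : 0 < a) (hb : 0 < b) (T : ℝ≥0∞) (hT : 0 < T) (γ : ℝ → ℝ × ℝ)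
    (hγ : ∀ t : ℝ, 0 ≤ t → ENNReal.ofReal t < T →
      HasDerivAt γ (lengyelEpstein a b (γ t)) t)
    (h0 : γ 0 ∈ firstQuadrant) :
    ∀ t : ℝ, 0 ≤ t → ENNReal.ofReal t < T → γ t ∈ firstQuadrant := by
  intro t ht htT
  have hderiv : ∀ s ∈ Set.Icc 0 t, HasDerivAt γ (lengyelEpstein a b (γ s)) s := fun s hs =>
    hγ s hs.1 ((ENNReal.ofReal_le_ofReal hs.2).trans_lt htT)
  have hx : ∀ s ∈ Set.Icc 0 t, 0 < (γ s).1 := fun s hs =>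
    pos_of_deriv_pos_of_eq_zero hs.1
      (fun r hr => (hderiv r ⟨hr.1, hr.2.trans hs.2⟩).fst) h0.1
      (fun r _ hr => by simpa [lengyelEpstein, hr] using ha)
  refine ⟨hx t ⟨ht, le_rfl⟩, pos_of_deriv_pos_of_eq_zero ht
    (fun s hs => (hderiv s hs).snd) h0.2 fun s hs hy => ?_⟩
  have := hx s hs
  simp only [lengyelEpstein, hy, sub_zero]
  positivity
end

section
/- For all parameters a > 0 and b > 0, the open half-plane {(x, y) ∈ ℝ² : x > 0} is positively invariant under the flow of the Lengyel–Epstein vector field F_{a,b}: for every T ∈ (0, ∞] and every solution γ : [0, T) → ℝ² of γ'(t) = F_{a,b}(γ(t)) whose initial point γ(0) has positive first coordinate, the first coordinate of γ(t) is positive for all t ∈ [0, T). -/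
open scoped ENNReal

/-- A real function that starts out positive stays positive if its derivative is positive at
each of its zeros. -/
theorem pos_of_hasDerivAt_pos_of_eq_zero_s6 {f f' : ℝ → ℝ} {t : ℝ} (ht : 0 ≤ t)
    (hf : ∀ s ∈ Set.Icc 0 t, HasDerivAt f (f' s) s)
    (hf' : ∀ s ∈ Set.Icc 0 t, f s = 0 → 0 < f' s) (h0 : 0 < f 0) : 0 < f t := by
  by_contra! hneg
  have hmem : ∀ s ∈ Set.Icc 0 t, t - s ∈ Set.Icc 0 t := fun s hs =>
    ⟨sub_nonneg.2 hs.2, sub_le_self t hs.1⟩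
  have hderiv : ∀ s ∈ Set.Icc 0 t, HasDerivAt (fun s => f (t - s)) (-f' (t - s)) s :=
    fun s hs => (hf _ (hmem s hs)).comp_const_sub t s
  have hle := image_le_of_deriv_right_lt_deriv_boundary (B := fun _ => 0) (B' := fun _ => 0)
    (fun s hs => (hderiv s hs).continuousAt.continuousWithinAt)
    (fun s hs => (hderiv s (Set.Ico_subset_Icc_self hs)).hasDerivWithinAt)
    (by simpa using hneg) (fun s => hasDerivAt_const s 0)
    (fun s hs hs0 => neg_lt_zero.2 (hf' _ (hmem s (Set.Ico_subset_Icc_self hs)) hs0))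
    (Set.right_mem_Icc.2 ht)
  simp only [sub_self] at hle
  exact hle.not_gt h0

/-- For all `a > 0`, `b > 0`, the open half-plane `x > 0` is positively
invariant under the flow of the Lengyel–Epstein vector field: any solution
`γ : [0, T) → ℝ²` whose initial point has positive first coordinate keeps a
positive first coordinate. -/
theorem lengyelEpstein_halfPlane_positively_invariant (a b : ℝ)
    (ha : 0 < a) (hb : 0 < b) (T : ℝ≥0∞) (hT : 0 < T) (γ : ℝ → ℝ × ℝ)
    (hγ : ∀ t : ℝ, 0 ≤ t → ENNReal.ofReal t < T →
      HasDerivAt γ (lengyelEpstein a b (γ t)) t)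
    (h0 : 0 < (γ 0).1) :
    ∀ t : ℝ, 0 ≤ t → ENNReal.ofReal t < T → 0 < (γ t).1 := by
  intro t ht htT
  refine pos_of_hasDerivAt_pos_of_eq_zero_s6 (f := fun s => (γ s).1)
    (f' := fun s => (lengyelEpstein a b (γ s)).1) ht (fun s hs => ?_) (fun s _ hs => ?_) h0
  · exact (hγ s hs.1 ((ENNReal.ofReal_le_ofReal hs.2).trans_lt htT)).fst
  · simpa [lengyelEpstein, hs] using ha
end

section
/- If (a, b) ∈ A, then the divergence of the rescaled vector field (1/x)·F_{a,b}(x, y) is negative throughout the open first quadrant: for all x > 0 one has a − b − 2x − a/x² < 0. (The divergence of the vector field G(x, y) = (1/x)·F_{a,b}(x, y) on Q₁ equals a − b − 2x − a/x², independent of y.) -/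
/-- Weighted AM-GM: `3c ≤ 2x + c³/x²` for `x > 0` and `c ≥ 0`. -/
theorem three_mul_le_two_mul_add_cube_div_sq {c x : ℝ} (hc : 0 ≤ c) (hx : 0 < x) :
    3 * c ≤ 2 * x + c ^ 3 / x ^ 2 := by
  have h : 2 * x + c ^ 3 / x ^ 2 - 3 * c = (x - c) ^ 2 * (2 * x + c) / x ^ 2 := by
    field_simp
    ring
  have h_nonneg : 0 ≤ (x - c) ^ 2 * (2 * x + c) / x ^ 2 := by positivity
  linarith

/-- If `c³ ≤ 3√3` with `c ≥ 0`, then `c³ ≤ 3c`. -/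
theorem cube_le_three_mul_of_cube_le {c : ℝ} (hc : 0 ≤ c) (h : c ^ 3 ≤ 3 * Real.sqrt 3) :
    c ^ 3 ≤ 3 * c := by
  have hs : Real.sqrt 3 ^ 2 = 3 := Real.sq_sqrt (by norm_num)
  have hcs : c ≤ Real.sqrt 3 := by
    refine le_of_pow_le_pow_left₀ three_ne_zero (Real.sqrt_nonneg 3) (h.trans_eq ?_)
    rw [pow_succ, hs]
  have hsq : c ^ 2 ≤ 3 := hs ▸ pow_le_pow_left₀ hc hcs 2
  nlinarith

/-- If `(a, b) ∈ A`, then the divergence `a - b - 2x - a/x²` of the rescaled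
Lengyel–Epstein vector field `(1/x)·F_{a,b}` is negative for all `x > 0`. -/
theorem lengyelEpstein_divergence_neg (a b : ℝ) (hA : (a, b) ∈ paramSetA) :
    ∀ x : ℝ, 0 < x → a - b - 2 * x - a / x ^ 2 < 0 := by
  intro x hx
  have ha : 0 < a := by
    rcases hA with h | h
    · exact h.1
    · exact lt_trans (by positivity) h.1
  have hc : 0 ≤ a ^ ((1 : ℝ) / 3) := by positivity
  have hcube : (a ^ ((1 : ℝ) / 3)) ^ 3 = a := by
    rw [← Real.rpow_mul_natCast ha.le]
    norm_num
  have hab : a - b < 3 * a ^ ((1 : ℝ) / 3) := by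
    rcases hA with ⟨-, hle, hb⟩ | ⟨-, hb⟩
    · have h := cube_le_three_mul_of_cube_le hc (hcube.trans_le hle)
      rw [hcube] at h
      dsimp only at hb
      linarith
    · dsimp only at hb
      linarith
  have hmin := three_mul_le_two_mul_add_cube_div_sq hc hx
  rw [hcube] at hmin
  linarith
end

section
/- The parameter set A is contained in the parameter set B: every pair (a, b) of positive reals with either 0 < a ≤ 3√3, or a > 3√3 and b > a − 3a^{1/3}, also satisfies either 0 < a ≤ 5√(5/3), or a > 5√(5/3) and b > (3a² − 125)/(5a). -/
/-- The boundary curve of `paramSetB` lies below that of `paramSetA`; in terms of `s = a ^ (2/3)`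
this is the inequality `(s - 5) ^ 2 * (2 * s + 5) ≥ 0`. -/
theorem div_le_sub_three_mul_rpow {a : ℝ} (ha : 0 < a) :
    (3 * a ^ 2 - 125) / (5 * a) ≤ a - 3 * a ^ ((1 : ℝ) / 3) := by
  have hcube : (a ^ ((1 : ℝ) / 3)) ^ 3 = a := by
    rw [← Real.rpow_natCast, ← Real.rpow_mul ha.le]
    norm_num
  generalize a ^ ((1 : ℝ) / 3) = t at hcube ⊢
  rw [div_le_iff₀ (by positivity)]
  subst hcube
  have h : 0 ≤ (t ^ 2 - 5) ^ 2 * (2 * t ^ 2 + 5) := by positivity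
  linear_combination h

theorem three_mul_sqrt_three_le : 3 * √(3 : ℝ) ≤ 5 * √(5 / 3) := by
  have h : √(3 : ℝ) ≤ √(5 / 3 * (5 / 3) ^ 2) := Real.sqrt_le_sqrt (by norm_num)
  rw [Real.sqrt_mul (by norm_num), Real.sqrt_sq (by norm_num)] at h
  linarith

/-- The parameter set `A` is contained in the parameter set `B`: every pair
`(a, b)` of positive reals lying in `A` also lies in `B`. -/
theorem paramSetA_subset_paramSetB (a b : ℝ) (ha : 0 < a) (hb : 0 < b)
    (hA : (a, b) ∈ paramSetA) : (a, b) ∈ paramSetB := by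
  rcases le_or_gt a (5 * Real.sqrt (5 / 3)) with h | h
  · exact Or.inl ⟨ha, h, hb⟩
  · rcases hA with ⟨-, h', -⟩ | ⟨-, h'⟩
    · exact absurd (h'.trans three_mul_sqrt_three_le) h.not_ge
    · exact Or.inr ⟨h, (div_le_sub_three_mul_rpow ha).trans_lt h'⟩
end

section
/- If (a, b) ∈ B, then both eigenvalues of the Jacobian matrix of the Lengyel–Epstein vector field F_{a,b} at the equilibrium P_a = (a/5, 1 + a²/25) have negative real part; that is, every complex root λ of the characteristic polynomial λ² − ((3a² − 125 − 5ab)/25)λ + ab(a² + 25)/25 satisfies Re λ < 0. -/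
/-- A monic real quadratic with negative trace and positive determinant has only roots with
negative real part. -/
theorem Complex.re_neg_of_quadratic_eq_zero {T D : ℝ} (hT : T < 0) (hD : 0 < D) {z : ℂ}
    (hz : z ^ 2 - (T : ℂ) * z + (D : ℂ) = 0) : z.re < 0 := by
  have hre := congrArg Complex.re hz
  have him := congrArg Complex.im hz
  simp [pow_two] at hre him
  have hfac : z.im * (2 * z.re - T) = 0 := by linarith
  rcases mul_eq_zero.mp hfac with h | h
  · by_contra! hx
    rw [h] at hre
    nlinarith [mul_nonneg hx (neg_nonneg.mpr hT.le), mul_self_nonneg z.re]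
  · linarith

/-- Points of `paramSetB` have positive coordinates and give a Jacobian of negative trace. -/
theorem pos_and_trace_neg_of_mem_paramSetB {a b : ℝ} (hB : (a, b) ∈ paramSetB) :
    0 < a ∧ 0 < b ∧ 3 * a ^ 2 - 125 - 5 * a * b < 0 := by
  have hs : Real.sqrt (5 / 3) ^ 2 = 5 / 3 := Real.sq_sqrt (by norm_num)
  have hs0 : 0 < Real.sqrt (5 / 3) := Real.sqrt_pos.mpr (by norm_num)
  rcases hB with ⟨ha, hle, hb⟩ | ⟨hlt, hb⟩
  · dsimp only at ha hle hb
    have hab := mul_pos ha hb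
    have hsq := pow_le_pow_left₀ ha.le hle 2
    exact ⟨ha, hb, by nlinarith⟩
  · dsimp only at hlt hb
    have ha : 0 < a := by linarith
    have hsq := pow_lt_pow_left₀ hlt (by positivity) two_ne_zero
    have hb0 : 0 < (3 * a ^ 2 - 125) / (5 * a) := div_pos (by nlinarith) (by positivity)
    have htr := (div_lt_iff₀ (by positivity)).mp hb
    exact ⟨ha, hb0.trans hb, by linarith⟩

/-- If `(a, b) ∈ B` then both eigenvalues of the Jacobian of the
Lengyel–Epstein field at `P_a` have negative real part: every complex root of
the characteristic polynomial `λ² - tr λ + det` with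
`tr = (3a² - 125 - 5ab)/25` and `det = ab(a² + 25)/25` has negative real
part. -/
theorem lengyelEpstein_eigenvalues_neg_re (a b : ℝ) (hB : (a, b) ∈ paramSetB) :
    ∀ lam : ℂ,
      lam ^ 2 - (((3 * a ^ 2 - 125 - 5 * a * b) / 25 : ℝ) : ℂ) * lam +
        ((a * b * (a ^ 2 + 25) / 25 : ℝ) : ℂ) = 0 →
      lam.re < 0 := by
  intro lam hlam
  obtain ⟨ha, hb, htr⟩ := pos_and_trace_neg_of_mem_paramSetB hB
  exact Complex.re_neg_of_quadratic_eq_zero (by linarith) (by positivity) hlam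
end
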